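/- Let n ≥ 3 and let p be a rational point of ℙ contained in a rational projective hyperplane L. Then for every δ ≥ ε > 0 there exists a finite subset S of 𝒰 such that (S, [p]_ε, [L]_δ) is a Schottky system and the subgroup of SL(n,ℤ) generated by S is profinitely dense. -/

import Mathlib

/- Common setup: `SL(n,ℤ)`, `SL(n,ℝ)`, the real projective space `ℙ^{n-1}(ℝ)`
with its quotient topology and the projective action, rank-1 unipotent elements
and their attracting points / fixed hyperplanes, metrics compatible with the
topology of `ℙ`, `ε`-neighbourhoods, Schottky systems, profinite density,
maximal subgroups, and lattices in `SL(n,ℝ)`. -/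

open Matrix LinearAlgebra.Projectivization

abbrev SLZ (n : ℕ) := Matrix.SpecialLinearGroup (Fin n) ℤ

abbrev SLR (n : ℕ) := Matrix.SpecialLinearGroup (Fin n) ℝ

/-- The real projective space `ℙ^{n-1}(ℝ)`: the projectivization of `ℝⁿ`. -/
abbrev Proj (n : ℕ) := Projectivization ℝ (Fin n → ℝ)

/-- The quotient topology on `ℙ^{n-1}(ℝ)`. -/
noncomputable instance (n : ℕ) : TopologicalSpace (Proj n) :=
  inferInstanceAs (TopologicalSpace (Quotient _))

/-- The action of `SL(n,ℝ)` on `ℙ^{n-1}(ℝ)` induced by the linear action on `ℝⁿ`. -/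
noncomputable def actR {n : ℕ} (g : SLR n) (x : Proj n) : Proj n :=
  Projectivization.map (Matrix.SpecialLinearGroup.toLin' g).toLinearMap
    (Matrix.SpecialLinearGroup.toLin' g).injective x

/-- The action of `SL(n,ℤ)` on `ℙ^{n-1}(ℝ)` induced by the linear action on `ℝⁿ`. -/
noncomputable def act {n : ℕ} (g : SLZ n) (x : Proj n) : Proj n :=
  actR (Matrix.SpecialLinearGroup.map (Int.castRingHom ℝ) g) x

/-- The real matrix attached to `g ∈ SL(n,ℤ)`. -/
noncomputable def matR {n : ℕ} (g : SLZ n) : Matrix (Fin n) (Fin n) ℝ :=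
  ((Matrix.SpecialLinearGroup.map (Int.castRingHom ℝ)) g : Matrix (Fin n) (Fin n) ℝ)

/-- The subspace `Im(u - I) ⊆ ℝⁿ` (a line when `u` is rank-1 unipotent). -/
noncomputable def lineOf {n : ℕ} (u : SLZ n) : Submodule ℝ (Fin n → ℝ) :=
  LinearMap.range (Matrix.mulVecLin (matR u - 1))

/-- The subspace `ker(u - I) ⊆ ℝⁿ` (a hyperplane when `u` is rank-1 unipotent). -/
noncomputable def hypOf {n : ℕ} (u : SLZ n) : Submodule ℝ (Fin n → ℝ) :=
  LinearMap.ker (Matrix.mulVecLin (matR u - 1))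

/-- The rational matrix attached to `g ∈ SL(n,ℤ)`. -/
noncomputable def matQ {n : ℕ} (g : SLZ n) : Matrix (Fin n) (Fin n) ℚ :=
  ((Matrix.SpecialLinearGroup.map (Int.castRingHom ℚ)) g : Matrix (Fin n) (Fin n) ℚ)

/-- `g - I`, as a `ℚ`-linear endomorphism of `ℚⁿ`. -/
noncomputable def linQ {n : ℕ} (g : SLZ n) : (Fin n → ℚ) →ₗ[ℚ] (Fin n → ℚ) :=
  Matrix.mulVecLin (matQ g - 1)

/-- `u` is a rank-1 unipotent element of `SL(n,ℤ)`: `u - I` is nilpotent of rank one. -/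
def IsR1U {n : ℕ} (u : SLZ n) : Prop :=
  IsNilpotent (linQ u) ∧ Module.finrank ℚ (LinearMap.range (linQ u)) = 1

/-- The point of attraction `p_u` of `u`, as a subset of `ℙ` (a singleton when `u` is a
rank-1 unipotent): the projective points whose representative spans `Im(u - I)`. -/
def attSet {n : ℕ} (u : SLZ n) : Set (Proj n) :=
  {x | x.submodule = lineOf u}

/-- The fixed hyperplane `L_u` of `u`, as a subset of `ℙ`. -/
def fixSet {n : ℕ} (u : SLZ n) : Set (Proj n) :=
  {x | x.submodule ≤ hypOf u}

/-- The subset of `ℙ` corresponding to a linear subspace `W ⊆ ℝⁿ`. -/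
def projSet {n : ℕ} (W : Submodule ℝ (Fin n → ℝ)) : Set (Proj n) :=
  {x | x.submodule ≤ W}

/-- The image `g • W` of a subspace of `ℝⁿ` under `g ∈ SL(n,ℤ)`. -/
noncomputable def actSub {n : ℕ} (g : SLZ n) (W : Submodule ℝ (Fin n → ℝ)) :
    Submodule ℝ (Fin n → ℝ) :=
  Submodule.map (Matrix.mulVecLin (matR g)) W

/-- The image `g • W` of a subspace of `ℝⁿ` under `g ∈ SL(n,ℝ)`. -/
noncomputable def actSubR {n : ℕ} (g : SLR n) (W : Submodule ℝ (Fin n → ℝ)) :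
    Submodule ℝ (Fin n → ℝ) :=
  Submodule.map (Matrix.mulVecLin (g : Matrix (Fin n) (Fin n) ℝ)) W

/-- `d` is a metric on `ℙ^{n-1}(ℝ)` inducing the quotient topology. -/
structure IsCompatMetric {n : ℕ} (d : Proj n → Proj n → ℝ) : Prop where
  self : ∀ x, d x x = 0
  eq_of : ∀ x y, d x y = 0 → x = y
  symm : ∀ x y, d x y = d y x
  triangle : ∀ x y z, d x z ≤ d x y + d y z
  inducing : ∀ s : Set (Proj n), IsOpen s ↔ ∀ x ∈ s, ∃ ε > 0, ∀ y, d x y < ε → y ∈ s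

/-- The distance from a point to a set. -/
noncomputable def setDist {n : ℕ} (d : Proj n → Proj n → ℝ) (x : Proj n)
    (A : Set (Proj n)) : ℝ :=
  sInf (d x '' A)

/-- The open `ε`-neighbourhood `(A)_ε = {x | dist(x, A) < ε}`. -/
def oThick {n : ℕ} (d : Proj n → Proj n → ℝ) (A : Set (Proj n)) (ε : ℝ) : Set (Proj n) :=
  {x | setDist d x A < ε}

/-- The closed `ε`-neighbourhood `[A]_ε = {x | dist(x, A) ≤ ε}`. -/
def cThick {n : ℕ} (d : Proj n → Proj n → ℝ) (A : Set (Proj n)) (ε : ℝ) : Set (Proj n) :=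
  {x | setDist d x A ≤ ε}

/-- The Hausdorff distance between two subsets of `ℙ`. -/
noncomputable def hDist {n : ℕ} (d : Proj n → Proj n → ℝ) (A B : Set (Proj n)) : ℝ :=
  max (sSup ((fun a => setDist d a B) '' A)) (sSup ((fun b => setDist d b A) '' B))

/-- A rational point of `ℙ`: one spanned by a vector of `ℚⁿ`. -/
def RatPoint {n : ℕ} (p : Proj n) : Prop :=
  ∃ v : Fin n → ℚ, p.submodule = Submodule.span ℝ {fun i => ((v i : ℝ))}

/-- A subspace of `ℝⁿ` spanned by vectors of `ℚⁿ`. -/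
def IsRatSubmodule {n : ℕ} (W : Submodule ℝ (Fin n → ℝ)) : Prop :=
  ∃ T : Set (Fin n → ℚ),
    W = Submodule.span ℝ ((fun (v : Fin n → ℚ) (i : Fin n) => ((v i : ℝ))) '' T)

/-- A Schottky system `(S, 𝒜, ℛ)` with respect to the metric `d`: `S` is a nonempty
set of rank-1 unipotents, `𝒜 ⊆ ℛ` are closed, and for each `u ∈ S` there are
`δ_u ≥ ε_u > 0` satisfying the ping-pong conditions. -/
structure IsSchottky {n : ℕ} (d : Proj n → Proj n → ℝ) (S : Set (SLZ n))
    (A R : Set (Proj n)) : Prop where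
  nonempty : S.Nonempty
  unip : ∀ u ∈ S, IsR1U u
  AsubR : A ⊆ R
  closedA : IsClosed A
  closedR : IsClosed R
  cond : ∃ ε δ : SLZ n → ℝ, (∀ u ∈ S, 0 < ε u ∧ ε u ≤ δ u) ∧
    (∀ u ∈ S, ∀ k : ℤ, k ≠ 0 → ∀ x, x ∉ oThick d (fixSet u) (δ u) →
      act (u ^ k) x ∈ oThick d (attSet u) (ε u)) ∧
    (∀ u ∈ S, ∀ v ∈ S, u ≠ v → oThick d (attSet u) (ε u) ∩ oThick d (fixSet v) (δ v) = ∅) ∧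
    (∀ u ∈ S, oThick d (attSet u) (ε u) ⊆ A) ∧
    (∀ u ∈ S, oThick d (fixSet u) (δ u) ⊆ R)

/-- `H` is profinitely dense in `G`: `HN = G` for every finite-index normal `N ⊴ G`. -/
def ProfinitelyDense {G : Type*} [Group G] (H : Subgroup G) : Prop :=
  ∀ N : Subgroup G, N.Normal → N.FiniteIndex → H ⊔ N = ⊤

/-- `M` is a maximal (proper) subgroup of `G`. -/
def IsMaxSubgroup {G : Type*} [Group G] (M : Subgroup G) : Prop :=
  M ≠ ⊤ ∧ ∀ K : Subgroup G, M < K → K = ⊤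

noncomputable instance (n : ℕ) : TopologicalSpace (SLR n) :=
  inferInstanceAs (TopologicalSpace {A : Matrix (Fin n) (Fin n) ℝ // A.det = 1})

noncomputable instance (n : ℕ) : MeasurableSpace (SLR n) := borel _

/-- `Γ ≤ SL(n,ℝ)` is a lattice: a discrete subgroup admitting a Borel fundamental
domain of finite Haar measure. -/
def IsLatticeIn {n : ℕ} (Γ : Subgroup (SLR n)) : Prop :=
  DiscreteTopology Γ ∧
  ∃ μ : MeasureTheory.Measure (SLR n), μ.IsHaarMeasure ∧
    ∃ D : Set (SLR n), MeasurableSet D ∧ μ D < ⊤ ∧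
      ∀ g : SLR n, ∃! γ : Γ, (γ : SLR n)⁻¹ * g ∈ D

open Matrix.SpecialLinearGroup (transvection)

/-- The subgroup of `SL(n,ℤ)` generated by the elementary matrices. -/
def elemSubgroup (n : ℕ) : Subgroup (SLZ n) :=
  Subgroup.closure {g | ∃ (i j : Fin n) (h : i ≠ j), g = transvection h 1}

lemma transvection_zpow {n : ℕ} {i j : Fin n} (h : i ≠ j) (b c : ℤ) :
    (transvection h b : SLZ n) ^ c = transvection h (b * c) := by
  let f : Multiplicative ℤ →* SLZ n :=
    { toFun := fun b => transvection h b.toAdd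
      map_one' := SpecialLinearGroup.transvection_coeff_zero h
      map_mul' := fun a b => (SpecialLinearGroup.transvection_add h _ _) }
  have := map_zpow f (Multiplicative.ofAdd b) c
  rw [← ofAdd_zsmul, smul_eq_mul, mul_comm] at this
  exact this.symm

lemma transvection_mem_elemSubgroup {n : ℕ} {i j : Fin n} (h : i ≠ j) (b : ℤ) :
    (transvection h b : SLZ n) ∈ elemSubgroup n := by
  have h1 : (transvection h 1 : SLZ n) ∈ elemSubgroup n := Subgroup.subset_closure ⟨i, j, h, rfl⟩
  simpa [transvection_zpow] using Subgroup.zpow_mem _ h1 b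

lemma transvection_mulVec {n : ℕ} {i j : Fin n} (h : i ≠ j) (b : ℤ) (v : Fin n → ℤ) :
    (transvection h b : SLZ n).1 *ᵥ v = v + Pi.single i (b * v j) := by
  rw [show (transvection h b : SLZ n).1 = Matrix.transvection i j b from rfl]
  ext k
  simp [Matrix.transvection, Matrix.add_mulVec, Matrix.single_mulVec, Pi.single_apply, Function.update_apply]

/-- Elements of the elementary subgroup fixing the basis vectors outside `t`. -/
def elemFix {n : ℕ} (t : Finset (Fin n)) : Subgroup (SLZ n) where
  carrier := {g | g ∈ elemSubgroup n ∧ ∀ k ∉ t, g.1 *ᵥ Pi.single k 1 = Pi.single k 1}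
  one_mem' := ⟨one_mem _, fun k _ => Matrix.one_mulVec _⟩
  mul_mem' := by
    rintro a b ⟨ha, ha'⟩ ⟨hb, hb'⟩
    refine ⟨mul_mem ha hb, fun k hk => ?_⟩
    change (a.1 * b.1) *ᵥ _ = _
    rw [← Matrix.mulVec_mulVec, hb' k hk, ha' k hk]
  inv_mem' := by
    rintro a ⟨ha, ha'⟩
    refine ⟨inv_mem ha, fun k hk => ?_⟩
    have h1 : (a⁻¹ : SLZ n).1 * a.1 = 1 := congrArg Subtype.val (inv_mul_cancel a)
    conv_lhs => rw [← ha' k hk]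
    rw [Matrix.mulVec_mulVec, h1, Matrix.one_mulVec]

lemma transvection_mem_elemFix {n : ℕ} {t : Finset (Fin n)} {i j : Fin n} (h : i ≠ j) (hj : j ∈ t)
    (b : ℤ) : (transvection h b : SLZ n) ∈ elemFix t := by
  refine ⟨transvection_mem_elemSubgroup h b, fun k hk => ?_⟩
  rw [transvection_mulVec]
  have : j ≠ k := fun e => hk (e ▸ hj)
  simp [this]

lemma exists_isUnit_entry {n : ℕ} (t : Finset (Fin n)) (ht : t.Nonempty) (v : Fin n → ℤ)
    (hv : ∀ c : ℤ, (∀ i ∈ t, c ∣ v i) → IsUnit c) :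
    ∃ g ∈ elemFix t, ∃ i ∈ t, IsUnit ((g.1 *ᵥ v) i) := by
  induction hN : ∑ i ∈ t, (v i).natAbs using Nat.strong_induction_on generalizing v with
  | _ N ih =>
    by_cases hex : ∃ i ∈ t, ∃ j ∈ t, i ≠ j ∧ v j ≠ 0 ∧ (v j).natAbs ≤ (v i).natAbs
    · obtain ⟨i, hi, j, hj, hij, hj0, hle⟩ := hex
      set g : SLZ n := transvection hij (-(v i / v j)) with hg
      have hgm : g ∈ elemFix t := transvection_mem_elemFix hij hj _
      have hgi : (g.1 *ᵥ v) i = v i % v j := by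
        rw [hg, transvection_mulVec]
        simp [Int.emod_def]; ring
      have hgk : ∀ k, k ≠ i → (g.1 *ᵥ v) k = v k := by
        intro k hk
        rw [hg, transvection_mulVec]
        simp [hk]
      have hlt : ∑ k ∈ t, ((g.1 *ᵥ v) k).natAbs < N := by
        rw [← hN]
        refine Finset.sum_lt_sum (fun k hk => ?_) ⟨i, hi, ?_⟩
        · rcases eq_or_ne k i with rfl | hk'
          · rw [hgi]
            have := Int.emod_nonneg (v k) hj0
            have := Int.emod_lt_abs (v k) hj0
            rw [Int.abs_eq_natAbs] at this
            omega
          · rw [hgk k hk']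
        · rw [hgi]
          have := Int.emod_nonneg (v i) hj0
          have := Int.emod_lt_abs (v i) hj0
          rw [Int.abs_eq_natAbs] at this
          omega
      obtain ⟨g', hg', k, hk, hu⟩ := ih _ hlt (g.1 *ᵥ v) (fun c hc => hv c fun k hk => by
        rcases eq_or_ne k i with rfl | hk'
        · have h1 := hc k hk
          have h2 := hc j hj
          rw [hgk j hij.symm] at h2
          rw [hgi] at h1
          rw [← Int.emod_add_mul_ediv (v k) (v j)]
          exact dvd_add h1 (h2.mul_right _)
        · rw [← hgk k hk']; exact hc k hk) rfl
      refine ⟨g' * g, mul_mem hg' hgm, k, hk, ?_⟩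
      change IsUnit (((g'.1 * g.1) *ᵥ v) k)
      rwa [← Matrix.mulVec_mulVec]
    · push Not at hex
      refine ⟨1, one_mem _, ?_⟩
      obtain ⟨i0, hi0⟩ := ht
      have : ∃ i ∈ t, ∀ j ∈ t, j ≠ i → v j = 0 := by
        by_cases h : ∃ i ∈ t, v i ≠ 0
        · obtain ⟨i, hi, hvi⟩ := h
          refine ⟨i, hi, fun j hj hji => ?_⟩
          by_contra h0
          have h1 := hex i hi j hj hji.symm h0
          have h2 := hex j hj i hi hji hvi
          omega
        · push Not at h
          exact ⟨i0, hi0, fun j hj _ => h j hj⟩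
      obtain ⟨i, hi, hz⟩ := this
      refine ⟨i, hi, ?_⟩
      have := hv (v i) (fun j hj => by
        rcases eq_or_ne j i with rfl | h
        · exact dvd_rfl
        · simp [hz j hj h])
      simpa using this

lemma exists_entry_eq_one {n : ℕ} (t : Finset (Fin n)) (a b : Fin n) (hab : a ≠ b) (ha : a ∈ t)
    (hb : b ∈ t) (v : Fin n → ℤ) (hv : ∀ c : ℤ, (∀ i ∈ t, c ∣ v i) → IsUnit c) :
    ∃ g ∈ elemFix t, (g.1 *ᵥ v) a = 1 := by
  have key : ∀ (i j : Fin n), i ≠ j → j ∈ t → ∀ v : Fin n → ℤ, IsUnit (v j) →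
      ∃ g ∈ elemFix t, (g.1 *ᵥ v) i = 1 := by
    intro i j hij hj v hu
    refine ⟨transvection hij (v j * (1 - v i)), transvection_mem_elemFix hij hj _, ?_⟩
    rw [transvection_mulVec]
    have := Int.isUnit_mul_self hu
    simp only [Pi.add_apply, Pi.single_eq_same]
    linear_combination (1 - v i) * this
  have comp : ∀ g ∈ elemFix t, (∃ g' ∈ elemFix t, (g'.1 *ᵥ (g.1 *ᵥ v)) a = 1) →
      ∃ g ∈ elemFix t, (g.1 *ᵥ v) a = 1 := by
    rintro g hg ⟨g', hg', h⟩
    exact ⟨g' * g, mul_mem hg' hg, by rw [Matrix.mulVec_mulVec] at h; exact h⟩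
  obtain ⟨g, hg, i, hi, hu⟩ := exists_isUnit_entry t ⟨a, ha⟩ v hv
  refine comp g hg ?_
  rcases eq_or_ne i a with rfl | hia
  · obtain ⟨g', hg', h'⟩ := key b i hab.symm ha _ hu
    obtain ⟨g'', hg'', h''⟩ := key i b hab hb (g'.1 *ᵥ (g.1 *ᵥ v)) (by rw [h']; exact isUnit_one)
    exact ⟨g'' * g', mul_mem hg'' hg', by rw [Matrix.mulVec_mulVec] at h''; exact h''⟩
  · exact key a i hia.symm hi _ hu

lemma exists_mulVec_eq_single {n : ℕ} (t : Finset (Fin n)) (a : Fin n) (ha : a ∈ t)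
    (v : Fin n → ℤ) (hv : v a = 1) : ∃ g ∈ elemFix t, g.1 *ᵥ v = Pi.single a 1 := by
  have : ∀ s : Finset (Fin n), a ∉ s → ∃ g ∈ elemFix t, ∀ k,
      (g.1 *ᵥ v) k = if k ∈ s then 0 else v k := by
    intro s
    induction s using Finset.induction_on with
    | empty => exact fun _ => ⟨1, one_mem _, by simp⟩
    | insert b s hb ih =>
      intro has
      rw [Finset.mem_insert, not_or] at has
      obtain ⟨g, hg, h⟩ := ih has.2
      refine ⟨transvection (Ne.symm has.1) (-(v b)) * g,
        mul_mem (transvection_mem_elemFix _ ha _) hg, fun k => ?_⟩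
      change (((transvection (Ne.symm has.1) (-(v b)) : SLZ n).1 * g.1) *ᵥ v) k = _
      rw [← Matrix.mulVec_mulVec, transvection_mulVec]
      simp only [Pi.add_apply, h, has.2, if_false, hv]
      rcases eq_or_ne k b with rfl | hk
      · simp [hb]
      · simp [hk]
  obtain ⟨g, hg, h⟩ := this (Finset.univ.erase a) (by simp)
  refine ⟨g, hg, ?_⟩
  ext k
  rw [h]
  rcases eq_or_ne k a with rfl | hk
  · simp [hv]
  · simp [hk]

theorem mem_elemSubgroup_of_fix {n : ℕ} (t : Finset (Fin n)) :
    ∀ A : SLZ n, (∀ k ∉ t, A.1 *ᵥ Pi.single k 1 = Pi.single k 1) → A ∈ elemSubgroup n := by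
  induction t using Finset.induction_on with
  | empty =>
    intro A hA
    have : A = 1 := by
      refine Subtype.ext (Matrix.ext fun i j => ?_)
      have := congrFun (hA j (by simp)) i
      simpa [Matrix.mulVec_single_one, Matrix.one_apply, Pi.single_apply] using this
    rw [this]; exact one_mem _
  | insert a t ha ih =>
    intro A hA
    suffices h : ∃ g ∈ elemFix (insert a t), g.1 *ᵥ (A.1 *ᵥ Pi.single a 1) = Pi.single a 1 by
      obtain ⟨g, hg, h⟩ := h
      have := ih (g * A) (fun k hk => by
        change (g.1 * A.1) *ᵥ _ = _
        rw [← Matrix.mulVec_mulVec]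
        rcases eq_or_ne k a with rfl | hka
        · exact h
        · have : k ∉ insert a t := by simp [hka, hk]
          rw [hA k this, hg.2 k this])
      simpa using mul_mem (inv_mem hg.1) this
    have hAinv : (A⁻¹ : SLZ n).1 * A.1 = 1 := congrArg Subtype.val (inv_mul_cancel A)
    have main : ∃ g ∈ elemFix (insert a t), (g.1 *ᵥ (A.1 *ᵥ Pi.single a 1)) a = 1 := by
      rcases t.eq_empty_or_nonempty with rfl | ⟨b, hb⟩
      · refine ⟨1, one_mem _, ?_⟩
        have h1 : A.1 = (1 : Matrix (Fin n) (Fin n) ℤ).updateCol a (A.1 *ᵥ Pi.single a 1) := by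
          ext i j
          rcases eq_or_ne j a with rfl | hj
          · simp
          · have := congrFun (hA j (by simp [hj])) i
            simp [Matrix.updateCol_ne hj] at this ⊢
            rw [this, Matrix.one_apply, Pi.single_apply]
        have h2 := A.2
        rw [h1, ← Matrix.cramer_apply, Matrix.cramer_one] at h2
        simpa using h2
      · refine exists_entry_eq_one (insert a t) a b (fun h => ha (h ▸ hb)) (by simp) (by simp [hb]) _
          fun c hc => ?_
        have h1 : (A⁻¹ : SLZ n).1 a ⬝ᵥ (A.1 *ᵥ Pi.single a 1) = 1 := by
          have := congrFun (Matrix.mulVec_mulVec (Pi.single a 1) (A⁻¹ : SLZ n).1 A.1) a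
          rw [hAinv, Matrix.one_mulVec, Pi.single_eq_same] at this
          exact this
        have h2 : ∀ k ∉ insert a t, (A⁻¹ : SLZ n).1 a k = 0 := by
          intro k hk
          have := congrFun (Matrix.mulVec_mulVec (Pi.single k 1) (A⁻¹ : SLZ n).1 A.1) a
          rw [hAinv, Matrix.one_mulVec, hA k hk, Matrix.mulVec_single_one, Pi.single_apply,
            if_neg (by rintro rfl; simp at hk)] at this
          exact this
        refine isUnit_of_dvd_one (h1 ▸ Finset.dvd_sum fun k _ => ?_)
        by_cases hk : k ∈ insert a t
        · exact (hc k hk).mul_left _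
        · rw [h2 k hk, zero_mul]; exact dvd_zero _
    obtain ⟨g, hg, h⟩ := main
    obtain ⟨g', hg', h'⟩ := exists_mulVec_eq_single (insert a t) a (by simp) _ h
    exact ⟨g' * g, mul_mem hg' hg, by rw [Matrix.mulVec_mulVec] at h'; exact h'⟩

theorem elemSubgroup_eq_top (n : ℕ) : elemSubgroup n = ⊤ :=
  eq_top_iff.2 fun A _ => mem_elemSubgroup_of_fix Finset.univ A (by simp)

open scoped commutatorElement

lemma exists_complementary_exponents (m c : ℕ) (hm : m ≠ 0) :
    ∃ x y : ℕ, 2 ^ c ∣ x ∧ 3 ^ c ∣ y ∧ m ∣ x * y ∧ x + y ≡ 1 [MOD m] := by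
  obtain ⟨a, b, hb, rfl⟩ := Nat.exists_eq_two_pow_mul_odd hm
  have h2b : Nat.Coprime 2 b := (Nat.coprime_two_left).2 hb
  have c1 : Nat.Coprime (2 ^ a * 2 ^ c) b := by
    rw [← pow_add]; exact h2b.pow_left _
  have c2 : Nat.Coprime (b * 3 ^ c) (2 ^ a) :=
    Nat.Coprime.mul_left (h2b.symm.pow_right _) (Nat.Coprime.pow _ _ (by norm_num))
  obtain ⟨x, hx0, hx1⟩ := Nat.chineseRemainder c1 0 1
  obtain ⟨y, hy0, hy1⟩ := Nat.chineseRemainder c2 0 1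
  rw [Nat.modEq_zero_iff_dvd] at hx0 hy0
  refine ⟨x, y, (Dvd.intro_left _ rfl).trans hx0, (Dvd.intro_left _ rfl).trans hy0,
    mul_dvd_mul ((Dvd.intro _ rfl).trans hx0) ((Dvd.intro _ rfl).trans hy0), ?_⟩
  refine (Nat.modEq_and_modEq_iff_modEq_mul (h2b.pow_left a)).1 ⟨?_, ?_⟩
  · have h := (Nat.modEq_zero_iff_dvd.2 ((Dvd.intro _ rfl).trans hx0 : 2 ^ a ∣ x)).add hy1
    simpa using h
  · have h := hx1.add (Nat.modEq_zero_iff_dvd.2 ((Dvd.intro _ rfl).trans hy0 : b ∣ y))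
    simpa using h

open SpecialLinearGroup in
lemma commute_transvection {n : ℕ} {i j k l : Fin n} (hij : i ≠ j) (hkl : k ≠ l)
    (hjk : j ≠ k) (hil : i ≠ l) (a b : ℤ) :
    Commute (transvection hij a : SLZ n) (transvection hkl b) := by
  refine Subtype.ext ?_
  change Matrix.transvection i j a * Matrix.transvection k l b =
    Matrix.transvection k l b * Matrix.transvection i j a
  simp only [Matrix.transvection, mul_add, add_mul, one_mul, mul_one,
    Matrix.single_mul_single_of_ne _ _ _ _ hjk, Matrix.single_mul_single_of_ne _ _ _ _ hil.symm]
  abel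

lemma transvection_mul_transvection_chain {n : ℕ} {i j k : Fin n} (hij : i ≠ j) (hjk : j ≠ k)
    (hik : i ≠ k) (a b : ℤ) :
    (transvection hij a : SLZ n) * transvection hjk b =
      transvection hik (a * b) * transvection hjk b * transvection hij a := by
  refine Subtype.ext ?_
  change Matrix.transvection i j a * Matrix.transvection j k b =
    Matrix.transvection i k (a * b) * Matrix.transvection j k b * Matrix.transvection i j a
  simp only [Matrix.transvection, mul_add, add_mul, one_mul, mul_one,
    Matrix.single_mul_single_same, Matrix.single_mul_single_of_ne _ _ _ _ hjk.symm,
    Matrix.single_mul_single_of_ne _ _ _ _ hik.symm,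
    add_zero]
  abel

lemma commutatorElement_transvection {n : ℕ} {i j k : Fin n} (hij : i ≠ j) (hjk : j ≠ k)
    (hik : i ≠ k) (a b : ℤ) :
    ⁅(transvection hij a : SLZ n), transvection hjk b⁆ = transvection hik (a * b) := by
  rw [commutatorElement_def, transvection_mul_transvection_chain hij hjk hik]
  group

section FiniteQuotient

variable {n : ℕ} {Q : Type*} [Group Q] (π : SLZ n →* Q)

lemma map_transvection_eq_one {i j : Fin n} (h : i ≠ j) {a : ℤ} (ha : (Nat.card Q : ℤ) ∣ a) :
    π (transvection h a) = 1 := by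
  obtain ⟨c, rfl⟩ := ha
  rw [mul_comm, ← transvection_zpow, map_zpow, zpow_natCast, pow_card_eq_one']

lemma map_transvection_eq_mul {i j : Fin n} (h : i ≠ j) {x y : ℕ} (hxy : x + y ≡ 1 [MOD Nat.card Q]) :
    π (transvection h 1) = π (transvection h x) * π (transvection h y) := by
  rw [← map_mul, ← SpecialLinearGroup.transvection_add]
  obtain ⟨c, hc⟩ := hxy.dvd
  have : (1 : ℤ) = ((x : ℤ) + y) + Nat.card Q * c := by push_cast at hc; linarith
  conv_lhs => rw [this]
  rw [SpecialLinearGroup.transvection_add, map_mul,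
    map_transvection_eq_one π h (Dvd.intro _ rfl), mul_one]

lemma commute_map_transvection_of_chain {i j k : Fin n} (hij : i ≠ j) (hjk : j ≠ k) (hik : i ≠ k)
    {x y : ℤ} (hxy : (Nat.card Q : ℤ) ∣ x * y) :
    Commute (π (transvection hij x)) (π (transvection hjk y)) := by
  rw [commute_iff_eq, ← map_mul, transvection_mul_transvection_chain hij hjk hik, map_mul, map_mul,
    map_transvection_eq_one π hik hxy, one_mul]

lemma commute_map_transvection_of_or {i j k l : Fin n} (hij : i ≠ j) (hkl : k ≠ l)
    (h : j ≠ k ∨ i ≠ l) {x y : ℤ} (hxy : (Nat.card Q : ℤ) ∣ x * y) :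
    Commute (π (transvection hij x)) (π (transvection hkl y)) := by
  by_cases hjk : j = k
  · subst hjk
    exact commute_map_transvection_of_chain π hij hkl (by tauto) hxy
  by_cases hil : i = l
  · subst hil
    exact (commute_map_transvection_of_chain π hkl hij (Ne.symm hjk) (mul_comm x y ▸ hxy)).symm
  exact (commute_transvection hij hkl hjk hil x y).map π

lemma commutatorElement_mul_right_of_commute {G : Type*} [Group G] {a b c : G} (h : Commute a c) :
    ⁅a, b * c⁆ = ⁅a, b⁆ := by
  have : c * a⁻¹ = a⁻¹ * c := h.symm.inv_right.eq
  rw [commutatorElement_def, commutatorElement_def]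
  calc a * (b * c) * a⁻¹ * (b * c)⁻¹ = a * b * (c * a⁻¹) * c⁻¹ * b⁻¹ := by group
    _ = _ := by rw [this]; group

lemma map_transvection_eq_commutator {i j r : Fin n} (hij : i ≠ j) (hir : i ≠ r) (hrj : r ≠ j)
    {x y : ℕ} (hxy : Nat.card Q ∣ x * y) (h1 : x + y ≡ 1 [MOD Nat.card Q]) :
    π (transvection hij x) = ⁅π (transvection hir x), π (transvection hrj x)⁆ := by
  have h : ⁅π (transvection hir x), π (transvection hrj 1)⁆ = π (transvection hij x) := by
    rw [← map_commutatorElement, commutatorElement_transvection hir hrj hij, mul_one]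
  rw [← h, map_transvection_eq_mul π hrj h1, commutatorElement_mul_right_of_commute]
  exact commute_map_transvection_of_chain π hir hrj hij (by exact_mod_cast hxy)

lemma exists_ne_ne (hn : 3 ≤ n) (i j : Fin n) : ∃ r, r ≠ i ∧ r ≠ j := by
  have : ({i, j} : Finset (Fin n)).card < Fintype.card (Fin n) := by
    rw [Fintype.card_fin]; exact lt_of_le_of_lt Finset.card_le_two hn
  obtain ⟨r, hr⟩ : ∃ r, r ∉ ({i, j} : Finset (Fin n)) := by
    by_contra! h
    rw [Finset.eq_univ_of_forall h, Finset.card_univ] at this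
    exact lt_irrefl _ this
  exact ⟨r, by simpa using hr⟩

lemma commute_map_transvection (hn : 3 ≤ n) {i j k l : Fin n} (hij : i ≠ j) (hkl : k ≠ l)
    {x y : ℕ} (hxy : Nat.card Q ∣ x * y) (h1 : x + y ≡ 1 [MOD Nat.card Q]) :
    Commute (π (transvection hij x)) (π (transvection hkl y)) := by
  have hxy' : (Nat.card Q : ℤ) ∣ x * y := by exact_mod_cast hxy
  by_cases h : j ≠ k ∨ i ≠ l
  · exact commute_map_transvection_of_or π hij hkl h hxy'
  push Not at h
  obtain ⟨rfl, rfl⟩ := h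
  obtain ⟨r, hri, hrj⟩ := exists_ne_ne hn i j
  rw [map_transvection_eq_commutator π hij hri.symm hrj hxy h1, commutatorElement_def]
  have c1 := commute_map_transvection_of_or π hri.symm hkl (Or.inl hrj) hxy'
  have c2 := commute_map_transvection_of_or π hrj hkl (Or.inr hri) hxy'
  exact ((c1.mul_left c2).mul_left c1.inv_left).mul_left c2.inv_left

/-- The subgroup generated by the `x`-th powers of the elementary matrices in a quotient. -/
def elemPow (x : ℕ) : Subgroup Q :=
  Subgroup.closure {q | ∃ (i j : Fin n) (h : i ≠ j), q = π (transvection h x)}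

lemma map_transvection_mem_elemPow {i j : Fin n} (h : i ≠ j) (x : ℕ) :
    π (transvection h x) ∈ elemPow π x := Subgroup.subset_closure ⟨i, j, h, rfl⟩

lemma commute_of_mem_elemPow (hn : 3 ≤ n) {x y : ℕ} (hxy : Nat.card Q ∣ x * y)
    (h1 : x + y ≡ 1 [MOD Nat.card Q]) {a b : Q} (ha : a ∈ elemPow π x) (hb : b ∈ elemPow π y) :
    Commute a b := by
  have h : elemPow π y ≤ Subgroup.centralizer {a} := by
    refine (Subgroup.closure_le _).2 ?_
    rintro _ ⟨k, l, hkl, rfl⟩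
    have h' : elemPow π x ≤ Subgroup.centralizer {π (transvection hkl y)} := by
      refine (Subgroup.closure_le _).2 ?_
      rintro _ ⟨i, j, hij, rfl⟩
      rw [SetLike.mem_coe, Subgroup.mem_centralizer_singleton_iff]
      exact (commute_map_transvection π hn hij hkl hxy h1).eq
    rw [SetLike.mem_coe, Subgroup.mem_centralizer_singleton_iff]
    exact (Subgroup.mem_centralizer_singleton_iff.1 (h' ha)).symm
  exact (Subgroup.mem_centralizer_singleton_iff.1 (h hb)).symm

lemma elemPow_sup_eq_top (hπ : Function.Surjective π) {x y : ℕ}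
    (h1 : x + y ≡ 1 [MOD Nat.card Q]) : elemPow π x ⊔ elemPow π y = ⊤ := by
  rw [eq_top_iff, ← MonoidHom.range_eq_top.2 hπ, MonoidHom.range_eq_map, ← elemSubgroup_eq_top,
    elemSubgroup, MonoidHom.map_closure, Subgroup.closure_le]
  rintro _ ⟨_, ⟨i, j, h, rfl⟩, rfl⟩
  rw [map_transvection_eq_mul π h h1]
  exact mul_mem (Subgroup.mem_sup_left (map_transvection_mem_elemPow π h x))
    (Subgroup.mem_sup_right (map_transvection_mem_elemPow π h y))

lemma elemPow_normal (hn : 3 ≤ n) (hπ : Function.Surjective π) {x y : ℕ}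
    (hxy : Nat.card Q ∣ x * y) (h1 : x + y ≡ 1 [MOD Nat.card Q]) : (elemPow π x).Normal := by
  rw [← Subgroup.normalizer_eq_top_iff, eq_top_iff, ← elemPow_sup_eq_top π hπ h1]
  refine sup_le Subgroup.le_normalizer fun b hb => ?_
  rw [Subgroup.mem_normalizer_iff]
  intro a
  constructor
  · intro ha
    rw [← (commute_of_mem_elemPow π hn hxy h1 ha hb).eq, mul_inv_cancel_right]
    exact ha
  · intro ha
    have := (commute_of_mem_elemPow π hn hxy h1 ha hb).eq
    rw [inv_mul_cancel_right, mul_assoc] at this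
    rwa [mul_assoc, ← mul_left_cancel this] at ha

theorem elemPow_le_of_forall_pow_mem (hn : 3 ≤ n) (hπ : Function.Surjective π) {x y : ℕ}
    (hxy : Nat.card Q ∣ x * y) (h1 : x + y ≡ 1 [MOD Nat.card Q]) (T : Set (SLZ n))
    (hT : Subgroup.closure T = ⊤)
    (hconj : ∀ t ∈ T, ∃ (g : SLZ n) (i j : Fin n) (h : i ≠ j), t = g * transvection h 1 * g⁻¹)
    (H : Subgroup Q) (hH : ∀ t ∈ T, π t ^ x ∈ H) : elemPow π x ≤ H := by
  have h1' : y + x ≡ 1 [MOD Nat.card Q] := add_comm x y ▸ h1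
  have hyx : Nat.card Q ∣ y * x := mul_comm x y ▸ hxy
  have := elemPow_normal π hn hπ hxy h1
  have := elemPow_normal π hn hπ hyx h1'
  have hpow : ∀ t ∈ T, ∀ z : ℕ, (elemPow π z).Normal → π t ^ z ∈ elemPow π z := by
    intro t ht z hz
    obtain ⟨g, i, j, h, rfl⟩ := hconj t ht
    rw [map_mul, map_mul, map_inv, conj_pow, ← map_pow, ← zpow_natCast, transvection_zpow, one_mul]
    exact hz.conj_mem _ (map_transvection_mem_elemPow π h z) _
  have htop : (H ⊓ elemPow π x) ⊔ elemPow π y = ⊤ := by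
    rw [eq_top_iff, ← MonoidHom.range_eq_top.2 hπ, MonoidHom.range_eq_map, ← hT,
      MonoidHom.map_closure, Subgroup.closure_le]
    rintro _ ⟨t, ht, rfl⟩
    have : π t = π t ^ x * π t ^ y := by
      rw [← pow_add]
      conv_lhs => rw [← pow_one (π t)]
      exact (pow_eq_pow_iff_modEq.2 (h1.symm.of_dvd (orderOf_dvd_natCard _)))
    rw [this]
    exact mul_mem (Subgroup.mem_sup_left ⟨hH t ht, hpow t ht x inferInstance⟩)
      (Subgroup.mem_sup_right (hpow t ht y inferInstance))
  have hdec : ∀ a ∈ elemPow π x, ∃ h ∈ H ⊓ elemPow π x, ∃ b ∈ elemPow π y ⊓ elemPow π x,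
      a = h * b := by
    intro a ha
    have : a ∈ (H ⊓ elemPow π x) ⊔ elemPow π y := htop ▸ Subgroup.mem_top a
    obtain ⟨h, hh, b, hb, rfl⟩ := Subgroup.mem_sup_of_normal_right.1 this
    exact ⟨h, hh, b, ⟨hb, (Subgroup.mul_mem_cancel_left _ hh.2).1 ha⟩, rfl⟩
  refine (Subgroup.closure_le _).2 ?_
  rintro _ ⟨i, j, hij, rfl⟩
  obtain ⟨r, hri, hrj⟩ := exists_ne_ne hn i j
  rw [map_transvection_eq_commutator π hij hri.symm hrj hxy h1]
  obtain ⟨h, hh, b, hb, e⟩ := hdec _ (map_transvection_mem_elemPow π hri.symm x)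
  obtain ⟨h', hh', b', hb', e'⟩ := hdec _ (map_transvection_mem_elemPow π hrj x)
  have comm := fun {a b : Q} => commute_of_mem_elemPow π hn hxy h1 (a := a) (b := b)
  have e2 : ⁅h * b, h' * b'⁆ = ⁅h, h'⁆ := by
    rw [commutatorElement_mul_right_of_commute
      ((comm hh.2 hb'.1).mul_left (comm hb.2 hb'.1)), ← _root_.inv_inj, commutatorElement_inv,
      commutatorElement_mul_right_of_commute (comm hh'.2 hb.1), commutatorElement_inv]
  rw [e, e', e2, commutatorElement_def]
  exact mul_mem (mul_mem (mul_mem hh.1 hh'.1) (inv_mem hh.1)) (inv_mem hh'.1)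

end FiniteQuotient

theorem profinitelyDense_of_pow_mem {n : ℕ} (hn : 3 ≤ n) (c : ℕ) (T₁ T₂ : Set (SLZ n))
    (h₁ : Subgroup.closure T₁ = ⊤) (h₂ : Subgroup.closure T₂ = ⊤)
    (hc₁ : ∀ t ∈ T₁, ∃ (g : SLZ n) (i j : Fin n) (h : i ≠ j), t = g * transvection h 1 * g⁻¹)
    (hc₂ : ∀ t ∈ T₂, ∃ (g : SLZ n) (i j : Fin n) (h : i ≠ j), t = g * transvection h 1 * g⁻¹)
    (H : Subgroup (SLZ n)) (hH₁ : ∀ t ∈ T₁, t ^ 2 ^ c ∈ H) (hH₂ : ∀ t ∈ T₂, t ^ 3 ^ c ∈ H) :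
    ProfinitelyDense H := by
  intro N hN hfin
  let π := QuotientGroup.mk' N
  have hπ : Function.Surjective π := QuotientGroup.mk'_surjective N
  obtain ⟨x, y, hx, hy, hxy, h1⟩ :=
    exists_complementary_exponents (Nat.card (SLZ n ⧸ N)) c Nat.card_pos.ne'
  have hmem : ∀ (t : SLZ n) (k z : ℕ), k ∣ z → t ^ k ∈ H → π t ^ z ∈ H.map π := by
    rintro t k _ ⟨w, rfl⟩ ht
    rw [pow_mul, ← map_pow]
    exact pow_mem (Subgroup.mem_map_of_mem π ht) w
  have hA := elemPow_le_of_forall_pow_mem π hn hπ hxy h1 T₁ h₁ hc₁ (H.map π)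
    fun t ht => hmem t _ x hx (hH₁ t ht)
  have hB := elemPow_le_of_forall_pow_mem π hn hπ (mul_comm x y ▸ hxy) (add_comm x y ▸ h1) T₂ h₂ hc₂
    (H.map π) fun t ht => hmem t _ y hy (hH₂ t ht)
  have htop : H.map π = ⊤ := eq_top_iff.2 (elemPow_sup_eq_top π hπ h1 ▸ sup_le hA hB)
  have := congrArg (Subgroup.comap π) htop
  rwa [Subgroup.comap_map_eq, QuotientGroup.ker_mk', Subgroup.comap_top] at this

lemma val_mul {n : ℕ} (a b : SLZ n) : (a * b).1 = a.1 * b.1 := rfl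

/-- `s` is the transvection `v ↦ v + (ψ ⬝ v) w`, where `ψ ⬝ w = 0`. -/
structure IsTv {n : ℕ} (s : SLZ n) (w ψ : Fin n → ℤ) : Prop where
  coe : (s : Matrix (Fin n) (Fin n) ℤ) = 1 + vecMulVec w ψ
  orth : ψ ⬝ᵥ w = 0

namespace IsTv

variable {n : ℕ} {s u : SLZ n} {w ψ x ξ : Fin n → ℤ}

lemma exists_of_orth (h : ψ ⬝ᵥ w = 0) : ∃ s : SLZ n, IsTv s w ψ :=
  ⟨⟨1 + vecMulVec w ψ, by
    rw [vecMulVec_eq Unit, det_one_add_replicateCol_mul_replicateRow, h, add_zero]⟩, rfl, h⟩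

lemma of_transvection {i j : Fin n} (h : i ≠ j) :
    IsTv (transvection h 1 : SLZ n) (Pi.single i 1) (Pi.single j 1) := by
  refine ⟨?_, by simp [h.symm]⟩
  rw [show (transvection h 1 : SLZ n).1 = Matrix.transvection i j 1 from rfl, Matrix.transvection]
  congr 1
  ext a b
  simp [vecMulVec_apply, Matrix.single_apply, Pi.single_apply, eq_comm, ← ite_and, and_comm]

lemma mulVec (h : IsTv s w ψ) (v : Fin n → ℤ) : s.1 *ᵥ v = v + (ψ ⬝ᵥ v) • w := by
  rw [h.coe, add_mulVec, one_mulVec, vecMulVec_mulVec]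
  simp

lemma vecMul (h : IsTv s w ψ) (φ : Fin n → ℤ) : φ ᵥ* s.1 = φ + (φ ⬝ᵥ w) • ψ := by
  rw [h.coe, vecMul_add, vecMul_one, vecMul_vecMulVec]

lemma eq (h : IsTv s w ψ) (h' : IsTv u w ψ) : s = u := Subtype.ext (h.coe.trans h'.coe.symm)

lemma mul {w' : Fin n → ℤ} (h : IsTv s w ψ) (h' : IsTv u w' ψ) : IsTv (s * u) (w + w') ψ := by
  refine ⟨?_, by rw [dotProduct_add, h.orth, h'.orth, add_zero]⟩
  rw [val_mul, h.coe, h'.coe, mul_add, mul_one, add_mul, one_mul,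
    vecMulVec_mul_vecMulVec, h'.orth, add_vecMulVec]
  simp [add_assoc]

lemma inv (h : IsTv s w ψ) : IsTv s⁻¹ (-w) ψ := by
  obtain ⟨t, ht⟩ := exists_of_orth (n := n) (w := -w) (ψ := ψ) (by simp [h.orth])
  have h1 := h.mul ht
  rw [add_neg_cancel] at h1
  have : s * t = 1 := h1.eq ⟨by simp, by simp⟩
  rwa [inv_eq_of_mul_eq_one_right this]

lemma pow (h : IsTv s w ψ) (k : ℕ) : IsTv (s ^ k) ((k : ℤ) • w) ψ := by
  induction k with
  | zero => exact ⟨by simp, by simp⟩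
  | succ k ih =>
    rw [pow_succ]
    convert ih.mul h using 1
    push_cast
    rw [add_smul, one_smul]

lemma zpow (h : IsTv s w ψ) (k : ℤ) : IsTv (s ^ k) (k • w) ψ := by
  obtain ⟨m, rfl | rfl⟩ := k.eq_nat_or_neg
  · rw [zpow_natCast]; exact h.pow m
  · rw [_root_.zpow_neg, zpow_natCast, neg_smul]; exact (h.pow m).inv

lemma conj (h : IsTv u x ξ) (g : SLZ n) :
    IsTv (g * u * g⁻¹) (g.1 *ᵥ x) (ξ ᵥ* (g⁻¹ : SLZ n).1) := by
  have hg : (g⁻¹ : SLZ n).1 * g.1 = 1 := congrArg Subtype.val (inv_mul_cancel g)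
  have hg' : g.1 * (g⁻¹ : SLZ n).1 = 1 := congrArg Subtype.val (mul_inv_cancel g)
  constructor
  · rw [val_mul, val_mul, h.coe, mul_add, mul_one, add_mul,
      hg', mul_vecMulVec, vecMulVec_mul]
  · rw [dotProduct_mulVec, vecMul_vecMul, hg, vecMul_one, h.orth]

lemma conj_zpow (h : IsTv u x ξ) (hs : IsTv s w ψ) (k : ℤ) :
    IsTv (s ^ k * u * (s ^ k)⁻¹) (x + (k * (ψ ⬝ᵥ x)) • w) (ξ - (k * (ξ ⬝ᵥ w)) • ψ) := by
  convert h.conj (s ^ k) using 1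
  · rw [(hs.zpow k).mulVec, smul_smul, mul_comm]
  · rw [(hs.zpow k).inv.vecMul, sub_eq_add_neg, dotProduct_neg, dotProduct_smul, neg_smul,
      smul_eq_mul]

end IsTv

/-- A generating family of conjugates of elementary transvections, pairwise in general position. -/
structure Fam {n : ℕ} {ι : Type*} (u : ι → SLZ n) (x ξ : ι → Fin n → ℤ) : Prop where
  tv : ∀ i, IsTv (u i) (x i) (ξ i)
  pair : ∀ i j, i ≠ j → ξ j ⬝ᵥ x i ≠ 0
  gen : Subgroup.closure (Set.range u) = ⊤
  conj_tv : ∀ i, ∃ (g : SLZ n) (a b : Fin n) (h : a ≠ b), u i = g * transvection h 1 * g⁻¹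

lemma closure_range_conj {G ι : Type*} [Group G] {u : ι → G}
    (hu : Subgroup.closure (Set.range u) = ⊤) (g : G) :
    Subgroup.closure (Set.range fun i => g * u i * g⁻¹) = ⊤ := by
  have := congrArg (Subgroup.map (MulAut.conj g).toMonoidHom) hu
  rw [MonoidHom.map_closure, ← Set.range_comp, Subgroup.map_top_of_surjective] at this
  · exact this
  · exact (MulAut.conj g).surjective

lemma Fam.conj_zpow {n : ℕ} {ι : Type*} {u : ι → SLZ n} {x ξ : ι → Fin n → ℤ} (F : Fam u x ξ)
    {s : SLZ n} {w ψ : Fin n → ℤ} (hs : IsTv s w ψ) (k : ℤ) :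
    Fam (fun i => s ^ k * u i * (s ^ k)⁻¹) (fun i => x i + (k * (ψ ⬝ᵥ x i)) • w)
      (fun i => ξ i - (k * (ξ i ⬝ᵥ w)) • ψ) where
  tv i := (F.tv i).conj_zpow hs k
  pair i j hij := by
    convert F.pair i j hij using 1
    simp only [sub_dotProduct, dotProduct_add, dotProduct_smul, smul_dotProduct, hs.orth,
      smul_eq_mul]
    ring
  gen := closure_range_conj F.gen _
  conj_tv i := by
    obtain ⟨g, a, b, h, e⟩ := F.conj_tv i
    exact ⟨s ^ k * g, a, b, h, by rw [e]; group⟩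

lemma exists_isTv_nonvanishing {n : ℕ} (hn : 3 ≤ n) :
    ∃ (s : SLZ n) (w ψ : Fin n → ℤ), IsTv s w ψ ∧ (∀ i, w i ≠ 0) ∧ (∀ i, ψ i ≠ 0) ∧
      ∃ (g : SLZ n) (a b : Fin n) (h : a ≠ b), s = g * transvection h 1 * g⁻¹ := by
  let e₀ : Fin n := ⟨0, by omega⟩
  let e₁ : Fin n := ⟨1, by omega⟩
  have h01 : e₀ ≠ e₁ := by simp [e₀, e₁]
  obtain ⟨h₁, hh₁⟩ := IsTv.exists_of_orth (n := n) (w := 1 - Pi.single e₀ 1)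
    (ψ := Pi.single e₀ 1) (by simp)
  obtain ⟨h₂, hh₂⟩ := IsTv.exists_of_orth (n := n) (w := Pi.single e₀ 1)
    (ψ := 1 - Pi.single e₀ 1) (by simp)
  refine ⟨_, _, _, ((IsTv.of_transvection h01).conj h₁).conj h₂, fun i => ?_, fun i => ?_,
    h₂ * h₁, e₀, e₁, h01, by group⟩
  · rw [hh₁.mulVec, hh₂.mulVec]
    have : (1 : Fin n → ℤ) ⬝ᵥ 1 = n := by simp [dotProduct]
    by_cases hi : i = e₀
    · subst hi
      simp [sub_dotProduct, this]
      omega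
    · simp [hi]
  · rw [hh₁.inv.vecMul, hh₂.inv.vecMul]
    by_cases hi : i = e₀
    · subst hi
      simp [h01]
    · by_cases hi' : i = e₁
      · subst hi'
        simp [h01, h01.symm]
      · simp [h01, hi, hi']

lemma exists_fam {n : ℕ} (hn : 3 ≤ n) :
    ∃ (ι : Type) (_ : Fintype ι) (u : ι → SLZ n) (x ξ : ι → Fin n → ℤ), Fam u x ξ := by
  obtain ⟨s, w, ψ, hs, hw, hψ, hconj⟩ := exists_isTv_nonvanishing hn
  let P := {p : Fin n × Fin n // p.1 ≠ p.2}
  let k : P → ℤ := fun p => 2 * (Fintype.equivFin P p : ℕ)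
  have hk : ∀ p q : P, p ≠ q → k p - k q ≤ -2 ∨ 2 ≤ k p - k q := fun p q hpq => by
    have : (Fintype.equivFin P p : ℕ) ≠ Fintype.equivFin P q := fun h =>
      hpq ((Fintype.equivFin P).injective (Fin.ext h))
    simp only [k]
    omega
  have hE : ∀ p : P, IsTv (s ^ k p * transvection p.2 1 * (s ^ k p)⁻¹)
      (Pi.single p.1.1 1 + (k p * (ψ ⬝ᵥ Pi.single p.1.1 1)) • w)
      (Pi.single p.1.2 1 - (k p * (Pi.single p.1.2 1 ⬝ᵥ w)) • ψ) :=
    fun p => (IsTv.of_transvection p.2).conj_zpow hs (k p)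
  refine ⟨Option P, inferInstance, fun o => o.elim s fun p => s ^ k p * transvection p.2 1 * (s ^ k p)⁻¹,
    fun o => o.elim w fun p => Pi.single p.1.1 1 + (k p * (ψ ⬝ᵥ Pi.single p.1.1 1)) • w,
    fun o => o.elim ψ fun p => Pi.single p.1.2 1 - (k p * (Pi.single p.1.2 1 ⬝ᵥ w)) • ψ,
    ?_, ?_, ?_, ?_⟩
  · rintro (_ | p)
    · exact hs
    · exact hE p
  · rintro (_ | p) (_ | q) h
    · exact absurd rfl h
    · simpa only [Option.elim, sub_dotProduct, smul_dotProduct, hs.orth, smul_zero, sub_zero,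
        single_one_dotProduct] using hw _
    · simpa only [Option.elim, dotProduct_add, dotProduct_smul, hs.orth, smul_zero, add_zero,
        dotProduct_single_one] using hψ _
    · have hpq := hk p q fun e => h (by rw [e])
      have h0 : ψ p.1.1 * w q.1.2 ≠ 0 := mul_ne_zero (hψ _) (hw _)
      have h1 : (Pi.single q.1.2 1 : Fin n → ℤ) p.1.1 = 0 ∨
          (Pi.single q.1.2 1 : Fin n → ℤ) p.1.1 = 1 := by
        rw [Pi.single_apply]; split_ifs <;> simp
      have h2 : (Option.some q).elim ψ (fun p => Pi.single p.1.2 1 - (k p * (Pi.single p.1.2 1 ⬝ᵥ w)) • ψ) ⬝ᵥ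
          (Option.some p).elim w (fun p => Pi.single p.1.1 1 + (k p * (ψ ⬝ᵥ Pi.single p.1.1 1)) • w) =
          (Pi.single q.1.2 1 : Fin n → ℤ) p.1.1 + (k p - k q) * (ψ p.1.1 * w q.1.2) := by
        simp only [Option.elim, sub_dotProduct, dotProduct_add, dotProduct_smul, smul_dotProduct,
          hs.orth, smul_eq_mul, single_one_dotProduct (v := w)]
        rw [dotProduct_single_one, dotProduct_single_one]
        ring
      rw [h2]
      generalize ψ p.1.1 * w q.1.2 = m at *
      generalize k p - k q = l at *
      intro h3
      have h4 : l * m = 0 ∨ l * m = -1 := by omega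
      rcases h4 with h4 | h4
      · rcases mul_eq_zero.1 h4 with h | h
        · omega
        · exact h0 h
      · have := Int.isUnit_iff.1 (IsUnit.of_mul_eq_one (a := l) (-m) (by linarith))
        omega
  · rw [eq_top_iff, ← elemSubgroup_eq_top, elemSubgroup, Subgroup.closure_le]
    rintro _ ⟨i, j, h, rfl⟩
    set H := Subgroup.closure (Set.range fun o : Option P =>
      o.elim s fun p => s ^ k p * transvection p.2 1 * (s ^ k p)⁻¹)
    have h1 : s ∈ H := Subgroup.subset_closure ⟨none, rfl⟩
    have h2 := Subgroup.zpow_mem _ h1 (k ⟨(i, j), h⟩)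
    have h3 : s ^ k ⟨(i, j), h⟩ * transvection h 1 * (s ^ k ⟨(i, j), h⟩)⁻¹ ∈ H :=
      Subgroup.subset_closure ⟨some ⟨(i, j), h⟩, rfl⟩
    have h4 := H.mul_mem (H.mul_mem (H.inv_mem h2) h3) h2
    rwa [mul_assoc, inv_mul_cancel_right, inv_mul_cancel_left] at h4
  · rintro (_ | p)
    · exact hconj
    · exact ⟨_, _, _, p.2, rfl⟩

lemma Fam.exists_dotProduct_ne_zero {n : ℕ} (hn : 3 ≤ n) {ι : Type*} {u : ι → SLZ n}
    {x ξ : ι → Fin n → ℤ} (F : Fam u x ξ) {v : Fin n → ℤ} (hv : v ≠ 0) : ∃ j, ξ j ⬝ᵥ v ≠ 0 := by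
  by_contra! H
  apply hv
  have hfix : ∀ g : SLZ n, g.1 *ᵥ v = v := fun g => by
    have hg : g ∈ Subgroup.closure (Set.range u) := F.gen ▸ Subgroup.mem_top g
    induction hg using Subgroup.closure_induction with
    | mem g hg =>
      obtain ⟨i, rfl⟩ := hg
      rw [(F.tv i).mulVec, H, zero_smul, add_zero]
    | one => exact one_mulVec v
    | mul a b _ _ ha hb => rw [val_mul, ← mulVec_mulVec, hb, ha]
    | inv a _ ha =>
      nth_rw 1 [← ha]
      rw [mulVec_mulVec, ← val_mul, inv_mul_cancel]
      exact one_mulVec v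
  ext j
  obtain ⟨i, hi, -⟩ := exists_ne_ne hn j j
  have := hfix (transvection hi 1)
  rw [transvection_mulVec] at this
  simpa using congrFun this i

lemma Fam.exists_dotProduct_ne_zero' {n : ℕ} (hn : 3 ≤ n) {ι : Type*} {u : ι → SLZ n}
    {x ξ : ι → Fin n → ℤ} (F : Fam u x ξ) {φ : Fin n → ℤ} (hφ : φ ≠ 0) : ∃ j, φ ⬝ᵥ x j ≠ 0 := by
  by_contra! H
  apply hφ
  have hfix : ∀ g : SLZ n, φ ᵥ* g.1 = φ := fun g => by
    have hg : g ∈ Subgroup.closure (Set.range u) := F.gen ▸ Subgroup.mem_top g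
    induction hg using Subgroup.closure_induction with
    | mem g hg =>
      obtain ⟨i, rfl⟩ := hg
      rw [(F.tv i).vecMul, H, zero_smul, add_zero]
    | one => exact vecMul_one φ
    | mul a b _ _ ha hb => rw [val_mul, ← vecMul_vecMul, ha, hb]
    | inv a _ ha =>
      nth_rw 1 [← ha]
      rw [vecMul_vecMul, ← val_mul, mul_inv_cancel]
      exact vecMul_one φ
  ext j
  obtain ⟨i, hi, -⟩ := exists_ne_ne hn j j
  have := hfix (transvection hi.symm 1)
  rw [(IsTv.of_transvection hi.symm).vecMul] at this
  simpa using congrFun this i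

lemma eventually_add_mul_ne_zero (a : ℤ) {c : ℤ} (hc : c ≠ 0) :
    ∀ᶠ k : ℕ in Filter.atTop, a + k * c ≠ 0 := by
  filter_upwards [Filter.eventually_gt_atTop a.natAbs] with k hk h
  have h1 : (k : ℤ) ∣ a := ⟨-c, by linarith⟩
  have h2 := Int.natAbs_dvd_natAbs.2 h1
  rcases Nat.eq_zero_or_pos a.natAbs with h3 | h3
  · rw [Int.natAbs_eq_zero.1 h3, zero_add] at h
    rcases mul_eq_zero.1 h with h | h
    · omega
    · exact hc h
  · exact absurd (Nat.le_of_dvd h3 h2) (by simpa using hk)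

lemma exists_fam_transverse {n : ℕ} (hn : 3 ≤ n) {v φ : Fin n → ℤ} (hv : v ≠ 0) (hφ : φ ≠ 0) :
    ∃ (ι : Type) (_ : Fintype ι) (u : ι → SLZ n) (x ξ : ι → Fin n → ℤ), Fam u x ξ ∧
      (∀ i, ξ i ⬝ᵥ v ≠ 0) ∧ ∀ i, φ ⬝ᵥ x i ≠ 0 := by
  obtain ⟨ι, hι, u, x, ξ, F⟩ := exists_fam hn
  obtain ⟨u, x, ξ, F, hξ⟩ : ∃ (u : ι → SLZ n) (x ξ : ι → Fin n → ℤ), Fam u x ξ ∧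
      ∀ i, ξ i ⬝ᵥ v ≠ 0 := by
    obtain ⟨j, hj⟩ := F.exists_dotProduct_ne_zero hn hv
    have hev : ∀ i, ∀ᶠ k : ℕ in Filter.atTop, (ξ i - (k * (ξ i ⬝ᵥ x j)) • ξ j) ⬝ᵥ v ≠ 0 := by
      intro i
      have hrw : ∀ k : ℕ, (ξ i - (k * (ξ i ⬝ᵥ x j)) • ξ j) ⬝ᵥ v =
          ξ i ⬝ᵥ v + k * (-(ξ i ⬝ᵥ x j) * (ξ j ⬝ᵥ v)) := fun k => by
        rw [sub_dotProduct, smul_dotProduct, smul_eq_mul]; ring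
      simp only [hrw]
      by_cases hij : i = j
      · subst hij
        simp [(F.tv i).orth, hj]
      · exact eventually_add_mul_ne_zero _
          (mul_ne_zero (neg_ne_zero.2 (F.pair j i (Ne.symm hij))) hj)
    obtain ⟨k, hk⟩ := (Filter.eventually_all.2 hev).exists
    exact ⟨_, _, _, F.conj_zpow (F.tv j) k, hk⟩
  obtain ⟨j, hj⟩ := F.exists_dotProduct_ne_zero' hn hφ
  have hev : ∀ i, ∀ᶠ k : ℕ in Filter.atTop, (ξ i - (k * (ξ i ⬝ᵥ x j)) • ξ j) ⬝ᵥ v ≠ 0 ∧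
      φ ⬝ᵥ (x i + (k * (ξ j ⬝ᵥ x i)) • x j) ≠ 0 := by
    intro i
    have hrw : ∀ k : ℕ, (ξ i - (k * (ξ i ⬝ᵥ x j)) • ξ j) ⬝ᵥ v =
        ξ i ⬝ᵥ v + k * (-(ξ i ⬝ᵥ x j) * (ξ j ⬝ᵥ v)) := fun k => by
      rw [sub_dotProduct, smul_dotProduct, smul_eq_mul]; ring
    have hrw' : ∀ k : ℕ, φ ⬝ᵥ (x i + (k * (ξ j ⬝ᵥ x i)) • x j) =
        φ ⬝ᵥ x i + k * ((ξ j ⬝ᵥ x i) * (φ ⬝ᵥ x j)) := fun k => by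
      rw [dotProduct_add, dotProduct_smul, smul_eq_mul]; ring
    simp only [hrw, hrw']
    by_cases hij : i = j
    · subst hij
      simp [(F.tv i).orth, hj, hξ i]
    · exact (eventually_add_mul_ne_zero _
          (mul_ne_zero (neg_ne_zero.2 (F.pair j i (Ne.symm hij))) (hξ j))).and
        (eventually_add_mul_ne_zero _ (mul_ne_zero (F.pair i j hij) hj))
  obtain ⟨k, hk⟩ := (Filter.eventually_all.2 hev).exists
  exact ⟨ι, hι, _, _, _, F.conj_zpow (F.tv j) k, fun i => (hk i).1, fun i => (hk i).2⟩

namespace IsCompatMetric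

variable {n : ℕ} {d : Proj n → Proj n → ℝ} {A B : Set (Proj n)} {η : ℝ}

lemma nonneg (hd : IsCompatMetric d) (x y : Proj n) : 0 ≤ d x y := by
  have h1 := hd.triangle x y x
  rw [hd.self, hd.symm y x] at h1
  linarith

lemma bddBelow (hd : IsCompatMetric d) (x : Proj n) : BddBelow (d x '' A) :=
  ⟨0, by rintro _ ⟨a, -, rfl⟩; exact hd.nonneg x a⟩

lemma mem_oThick (hd : IsCompatMetric d) (hA : A.Nonempty) {x : Proj n} : x ∈ oThick d A η ↔ ∃ a ∈ A, d x a < η := by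
  rw [oThick, Set.mem_ofPred_eq, setDist, csInf_lt_iff (hd.bddBelow x) (hA.image _)]
  simp

lemma setDist_le_add (hd : IsCompatMetric d) (hA : A.Nonempty) (x y : Proj n) :
    setDist d x A ≤ d x y + setDist d y A := by
  rw [← sub_le_iff_le_add']
  refine le_csInf (hA.image _) ?_
  rintro _ ⟨a, ha, rfl⟩
  rw [sub_le_iff_le_add']
  exact (csInf_le (hd.bddBelow x) ⟨a, ha, rfl⟩).trans (hd.triangle x y a)

lemma isOpen_oThick (hd : IsCompatMetric d) (hA : A.Nonempty) (η : ℝ) : IsOpen (oThick d A η) := by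
  refine (hd.inducing _).2 fun x hx => ?_
  have hx : setDist d x A < η := hx
  refine ⟨η - setDist d x A, sub_pos.2 hx, fun y hy => ?_⟩
  have := hd.setDist_le_add hA y x
  rw [hd.symm] at this
  change setDist d y A < η
  linarith

lemma isClosed_cThick (hd : IsCompatMetric d) (hA : A.Nonempty) (η : ℝ) : IsClosed (cThick d A η) := by
  rw [← isOpen_compl_iff]
  refine (hd.inducing _).2 fun x hx => ?_
  have hx : η < setDist d x A := lt_of_not_ge hx
  refine ⟨setDist d x A - η, sub_pos.2 hx, fun y hy => ?_⟩
  have := hd.setDist_le_add hA x y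
  change ¬ setDist d y A ≤ η
  linarith

lemma subset_oThick (hd : IsCompatMetric d) (hη : 0 < η) : A ⊆ oThick d A η := fun x hx =>
  (hd.mem_oThick ⟨x, hx⟩).2 ⟨x, hx, by rwa [hd.self]⟩

lemma cThick_singleton_subset (hd : IsCompatMetric d) {p : Proj n} (hp : p ∈ A) {ε δ : ℝ} (h : ε ≤ δ) :
    cThick d {p} ε ⊆ cThick d A δ := by
  intro x hx
  have hx : setDist d x {p} ≤ ε := hx
  rw [setDist, Set.image_singleton, csInf_singleton] at hx
  exact ((csInf_le (hd.bddBelow x) ⟨p, hp, rfl⟩).trans hx).trans h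

lemma oThick_subset_cThick (hd : IsCompatMetric d) (hA : A.Nonempty) {δ : ℝ} (hAB : A ⊆ oThick d B (δ / 2))
    (hB : B.Nonempty) (hη : η ≤ δ / 2) : oThick d A η ⊆ cThick d B δ := by
  intro x hx
  obtain ⟨a, ha, hxa⟩ := (hd.mem_oThick hA).1 hx
  have h1 := hd.setDist_le_add hB x a
  have h2 : setDist d a B < δ / 2 := hAB ha
  change setDist d x B ≤ δ
  linarith

lemma eventually_disjoint (hd : IsCompatMetric d) {q : Proj n} (hA : A.Nonempty) (hAc : IsClosed A) (hq : q ∉ A) :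
    ∀ᶠ η in nhdsWithin (0 : ℝ) (Set.Ioi 0), oThick d {q} η ∩ oThick d A η = ∅ := by
  obtain ⟨ρ, hρ, h⟩ := (hd.inducing _).1 hAc.isOpen_compl q hq
  filter_upwards [Ioo_mem_nhdsGT (half_pos hρ)] with η hη
  refine Set.eq_empty_of_forall_notMem fun x hx => ?_
  obtain ⟨q', hq', h1⟩ := (hd.mem_oThick (Set.singleton_nonempty q)).1 hx.1
  obtain ⟨a, ha, h2⟩ := (hd.mem_oThick hA).1 hx.2
  refine h a ?_ ha
  rw [Set.mem_singleton_iff.1 hq'] at h1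
  have h3 := hd.triangle q x a
  rw [hd.symm q x] at h3
  linarith [hη.2]

end IsCompatMetric

section Projective

variable {n : ℕ} {U : Set (Proj n)}

lemma isOpen_mk_preimage (hU : IsOpen U) :
    IsOpen {y : Fin n → ℝ | ∃ hy : y ≠ 0, Projectivization.mk ℝ y hy ∈ U} := by
  have h1 : IsOpen (Projectivization.mk' ℝ ⁻¹' U : Set {y : Fin n → ℝ // y ≠ 0}) :=
    isOpen_coinduced.1 hU
  convert (isOpen_ne (x := (0 : Fin n → ℝ))).isOpenMap_subtype_val _ h1 using 1
  ext y
  simp [Projectivization.mk'_eq_mk]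

lemma exists_mk_mem_of_isOpen (hU : IsOpen U) {v : Fin n → ℝ} (hv : v ≠ 0)
    (h : Projectivization.mk ℝ v hv ∈ U) :
    ∃ r > 0, ∀ y (hy : y ≠ 0), ‖y - v‖ < r → Projectivization.mk ℝ y hy ∈ U := by
  obtain ⟨r, hr, H⟩ := Metric.isOpen_iff.1 (isOpen_mk_preimage hU) v ⟨hv, h⟩
  refine ⟨r, hr, fun y _ hyr => ?_⟩
  obtain ⟨_, h⟩ := H (mem_ball_iff_norm.2 hyr)
  exact h

/-- The projective hyperplane on which the linear form `ξ` vanishes. -/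
def hypSet (ξ : Fin n → ℝ) : Set (Proj n) := {q | ∀ y ∈ q.submodule, ξ ⬝ᵥ y = 0}

lemma mk_mem_hypSet {ξ y : Fin n → ℝ} (hy : y ≠ 0) :
    Projectivization.mk ℝ y hy ∈ hypSet ξ ↔ ξ ⬝ᵥ y = 0 := by
  rw [hypSet, Set.mem_ofPred_eq, Projectivization.submodule_mk]
  refine ⟨fun h => h y (Submodule.mem_span_singleton_self y), fun h z hz => ?_⟩
  obtain ⟨a, rfl⟩ := Submodule.mem_span_singleton.1 hz
  rw [dotProduct_smul, h, smul_zero]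

lemma isClosed_hypSet (ξ : Fin n → ℝ) : IsClosed (hypSet ξ) := by
  rw [← isOpen_compl_iff]
  refine isOpen_coinduced.2 ?_
  have h : IsOpen {y : {y : Fin n → ℝ // y ≠ 0} | ξ ⬝ᵥ y.1 ≠ 0} := by
    refine isOpen_ne.preimage (f := fun y : {y : Fin n → ℝ // y ≠ 0} => ξ ⬝ᵥ y.1) ?_
    exact continuous_const.dotProduct continuous_subtype_val
  convert h using 1
  ext y
  exact not_congr (mk_mem_hypSet y.2)

lemma exists_le_abs_dotProduct (hU : IsOpen U) {ξ : Fin n → ℝ} (h : hypSet ξ ⊆ U) :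
    ∃ c > 0, ∀ y (hy : y ≠ 0), Projectivization.mk ℝ y hy ∉ U → c * ‖y‖ ≤ |ξ ⬝ᵥ y| := by
  set V := {y : Fin n → ℝ | ∃ hy : y ≠ 0, Projectivization.mk ℝ y hy ∈ U}
  have hK : IsCompact (Metric.sphere (0 : Fin n → ℝ) 1 \ V) :=
    (isCompact_sphere _ _).diff (isOpen_mk_preimage hU)
  have hpos : ∀ y ∈ Metric.sphere (0 : Fin n → ℝ) 1 \ V, 0 < |ξ ⬝ᵥ y| := by
    rintro y ⟨hy1, hy2⟩
    have hy0 : y ≠ 0 := by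
      rintro rfl
      simp at hy1
    exact abs_pos.2 fun h0 => hy2 ⟨hy0, h ((mk_mem_hypSet hy0).2 h0)⟩
  obtain ⟨c, hc, hcK⟩ : ∃ c > 0, ∀ y ∈ Metric.sphere (0 : Fin n → ℝ) 1 \ V, c ≤ |ξ ⬝ᵥ y| := by
    rcases (Metric.sphere (0 : Fin n → ℝ) 1 \ V).eq_empty_or_nonempty with he | hne
    · exact ⟨1, one_pos, by simp [he]⟩
    · obtain ⟨y, hy, hmin⟩ := hK.exists_isMinOn hne
        (f := fun y => |ξ ⬝ᵥ y|) (continuous_const.dotProduct continuous_id).abs.continuousOn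
      exact ⟨_, hpos y hy, fun z hz => hmin hz⟩
  refine ⟨c, hc, fun y hy hyU => ?_⟩
  have hy' : 0 < ‖y‖ := norm_pos_iff.2 hy
  have hz : ‖y‖⁻¹ • y ∈ Metric.sphere (0 : Fin n → ℝ) 1 \ V := by
    refine ⟨by simp [norm_smul, hy'.ne'], fun ⟨h0, h1⟩ => hyU ?_⟩
    convert h1 using 1
    exact (Projectivization.mk_eq_mk_iff' ℝ _ _ _ _).2 ⟨‖y‖, by simp [smul_smul, hy'.ne']⟩
  have := hcK _ hz
  rw [dotProduct_smul, smul_eq_mul, abs_mul, abs_of_pos (inv_pos.2 hy'), inv_mul_eq_div,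
    le_div_iff₀ hy'] at this
  exact this

lemma exists_forall_mk_mem {V : Set (Proj n)} (hU : IsOpen U) (hV : IsOpen V) {X Ξ : Fin n → ℝ}
    (hX : X ≠ 0) (hXV : Projectivization.mk ℝ X hX ∈ V) (hΞ : hypSet Ξ ⊆ U) :
    ∃ M : ℝ, ∀ m : ℝ, M ≤ |m| → ∀ y (hy : y ≠ 0), Projectivization.mk ℝ y hy ∉ U →
      ∀ h : y + (m * (Ξ ⬝ᵥ y)) • X ≠ 0, Projectivization.mk ℝ _ h ∈ V := by
  obtain ⟨r, hr, hrV⟩ := exists_mk_mem_of_isOpen hV hX hXV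
  obtain ⟨c, hc, hcU⟩ := exists_le_abs_dotProduct hU hΞ
  refine ⟨2 * (r * c)⁻¹, fun m hm y hy hyU h => ?_⟩
  have hrc : 0 < (r * c)⁻¹ := inv_pos.2 (mul_pos hr hc)
  have hm0 : 0 < |m| := by linarith
  have hy0 : 0 < ‖y‖ := norm_pos_iff.2 hy
  have h1 := hcU y hy hyU
  have h2 : 0 < |Ξ ⬝ᵥ y| := lt_of_lt_of_le (mul_pos hc hy0) h1
  set t := m * (Ξ ⬝ᵥ y) with ht
  have ht0 : t ≠ 0 := mul_ne_zero (abs_pos.1 hm0) (abs_pos.1 h2)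
  have hz : X + t⁻¹ • y ≠ 0 := by
    intro h0
    apply h
    rw [← smul_zero t, ← h0, smul_add, smul_smul, mul_inv_cancel₀ ht0, one_smul, add_comm]
  have h3 : Projectivization.mk ℝ _ h = Projectivization.mk ℝ _ hz :=
    (Projectivization.mk_eq_mk_iff' ℝ _ _ _ _).2 ⟨t, by
      rw [smul_add, smul_smul, mul_inv_cancel₀ ht0, one_smul, add_comm]⟩
  rw [h3]
  refine hrV _ hz ?_
  rw [add_sub_cancel_left, norm_smul, norm_inv, Real.norm_eq_abs, ht, abs_mul, inv_mul_lt_iff₀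
    (mul_pos hm0 h2)]
  have h4 : (r * c)⁻¹ < |m| := by linarith
  rw [inv_lt_iff_one_lt_mul₀ (mul_pos hr hc)] at h4
  calc ‖y‖ = 1 * ‖y‖ := (one_mul _).symm
    _ < (|m| * (r * c)) * ‖y‖ := by gcongr
    _ = |m| * r * (c * ‖y‖) := by ring
    _ ≤ |m| * r * |Ξ ⬝ᵥ y| := by gcongr
    _ = |m| * |Ξ ⬝ᵥ y| * r := by ring

lemma eventually_mk_mem (hU : IsOpen U) {v : Fin n → ℝ} (hv : v ≠ 0)
    (h : Projectivization.mk ℝ v hv ∈ U) (x : Fin n → ℝ) {b : ℝ} (hb : b ≠ 0) :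
    ∀ᶠ a : ℕ in Filter.atTop, ∀ h : x + (a * b) • v ≠ 0, Projectivization.mk ℝ _ h ∈ U := by
  obtain ⟨r, hr, H⟩ := exists_mk_mem_of_isOpen hU hv h
  have ht : Filter.Tendsto (fun a : ℕ => ‖((a : ℝ)⁻¹ * b⁻¹) • x‖) Filter.atTop (nhds 0) := by
    have h1 : Filter.Tendsto (fun a : ℕ => (a : ℝ)⁻¹) Filter.atTop (nhds 0) :=
      tendsto_inv_atTop_nhds_zero_nat
    have h2 := ((h1.mul_const b⁻¹).smul_const x).norm
    simpa using h2
  filter_upwards [ht.eventually_lt_const hr, Filter.eventually_gt_atTop 0] with a ha ha0 h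
  have hab : (a * b : ℝ) ≠ 0 := mul_ne_zero (by positivity) hb
  have hz : ((a : ℝ)⁻¹ * b⁻¹) • x + v ≠ 0 := by
    intro h0
    apply h
    rw [← smul_zero (a * b : ℝ), ← h0, smul_add, smul_smul, ← mul_inv, mul_inv_cancel₀ hab, one_smul]
  have h3 : Projectivization.mk ℝ _ h = Projectivization.mk ℝ _ hz :=
    (Projectivization.mk_eq_mk_iff' ℝ _ _ _ _).2 ⟨a * b, by
      rw [smul_add, smul_smul, ← mul_inv, mul_inv_cancel₀ hab, one_smul]⟩
  rw [h3]
  exact H _ hz (by rwa [add_sub_cancel_right])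

lemma abs_dotProduct_le (ξ y : Fin n → ℝ) : |ξ ⬝ᵥ y| ≤ (∑ i, |ξ i|) * ‖y‖ := by
  rw [dotProduct, Finset.sum_mul]
  refine (Finset.abs_sum_le_sum_abs _ _).trans (Finset.sum_le_sum fun i _ => ?_)
  rw [abs_mul]
  exact mul_le_mul_of_nonneg_left (norm_le_pi_norm y i) (abs_nonneg _)

lemma eventually_hypSet_subset (hU : IsOpen U) {φ : Fin n → ℝ} (h : hypSet φ ⊆ U)
    (ξ : Fin n → ℝ) {b : ℝ} (hb : b ≠ 0) :
    ∀ᶠ a : ℕ in Filter.atTop, hypSet (ξ - (a * b) • φ) ⊆ U := by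
  obtain ⟨c, hc, hcU⟩ := exists_le_abs_dotProduct hU h
  have ht : Filter.Tendsto (fun a : ℕ => a * (|b| * c)) Filter.atTop Filter.atTop :=
    tendsto_natCast_atTop_atTop.atTop_mul_const (mul_pos (abs_pos.2 hb) hc)
  filter_upwards [ht.eventually_gt_atTop (∑ i, |ξ i|)] with a ha q hq
  induction q using Projectivization.ind with
  | h y hy =>
    by_contra hyU
    rw [mk_mem_hypSet, sub_dotProduct, smul_dotProduct, sub_eq_zero, smul_eq_mul] at hq
    have h1 := hcU y hy hyU
    have h2 := abs_dotProduct_le ξ y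
    rw [hq, abs_mul, abs_mul, Nat.abs_cast] at h2
    have h3 : a * |b| * (c * ‖y‖) ≤ a * |b| * |φ ⬝ᵥ y| := by gcongr
    have h4 : (∑ i, |ξ i|) * ‖y‖ < a * (|b| * c) * ‖y‖ := by
      gcongr
    linarith

end Projective

lemma intCast_dotProduct {n : ℕ} (R : Type*) [CommRing R] (ξ x : Fin n → ℤ) :
    (fun i => (ξ i : R)) ⬝ᵥ (fun i => (x i : R)) = ((ξ ⬝ᵥ x : ℤ) : R) := by
  simp [dotProduct]

lemma intCast_ne_zero {n : ℕ} {R : Type*} [CommRing R] [CharZero R] {x : Fin n → ℤ} (h : x ≠ 0) :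
    (fun i => (x i : R)) ≠ 0 := by
  contrapose! h
  ext i
  simpa using congrFun h i

lemma range_mulVecLin_vecMulVec {n : ℕ} {K : Type*} [Field K] (a : Fin n → K) {b : Fin n → K}
    (hb : b ≠ 0) : LinearMap.range (vecMulVec a b).mulVecLin = Submodule.span K {a} := by
  apply le_antisymm
  · rintro _ ⟨y, rfl⟩
    rw [mulVecLin_apply, vecMulVec_mulVec, op_smul_eq_smul]
    exact Submodule.smul_mem _ _ (Submodule.mem_span_singleton_self a)
  · rw [Submodule.span_singleton_le_iff_mem]
    obtain ⟨i, hi⟩ := Function.ne_iff.1 hb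
    refine ⟨Pi.single i (b i)⁻¹, ?_⟩
    rw [mulVecLin_apply, vecMulVec_mulVec, op_smul_eq_smul, dotProduct_single,
      mul_inv_cancel₀ hi, one_smul]

namespace IsTv

variable {n : ℕ} {u : SLZ n} {x ξ : Fin n → ℤ}

lemma map_coe (h : IsTv u x ξ) (R : Type*) [CommRing R] :
    (SpecialLinearGroup.map (Int.castRingHom R) u : Matrix (Fin n) (Fin n) R) =
      1 + vecMulVec (fun i => (x i : R)) (fun i => (ξ i : R)) := by
  rw [SpecialLinearGroup.map_apply_coe, h.coe]
  ext i j
  simp [vecMulVec_apply, Matrix.one_apply, apply_ite]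

lemma attSet_eq (h : IsTv u x ξ) (hx : x ≠ 0) (hξ : ξ ≠ 0) :
    attSet u = {Projectivization.mk ℝ (fun i => (x i : ℝ)) (intCast_ne_zero hx)} := by
  ext q
  rw [attSet, Set.mem_ofPred_eq, lineOf, matR, h.map_coe, add_sub_cancel_left,
    range_mulVecLin_vecMulVec _ (intCast_ne_zero hξ), Set.mem_singleton_iff,
    ← Projectivization.submodule_mk _ (intCast_ne_zero hx), Projectivization.submodule_injective.eq_iff]

lemma fixSet_eq (h : IsTv u x ξ) (hx : x ≠ 0) : fixSet u = hypSet fun i => (ξ i : ℝ) := by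
  ext q
  rw [fixSet, Set.mem_ofPred_eq, hypOf, matR, h.map_coe, add_sub_cancel_left]
  refine forall₂_congr fun y _ => ?_
  rw [LinearMap.mem_ker, mulVecLin_apply, vecMulVec_mulVec, op_smul_eq_smul, smul_eq_zero,
    or_iff_left (intCast_ne_zero hx)]

lemma isR1U (h : IsTv u x ξ) (hx : x ≠ 0) (hξ : ξ ≠ 0) : IsR1U u := by
  have h1 : linQ u = (vecMulVec (fun i => (x i : ℚ)) (fun i => (ξ i : ℚ))).mulVecLin := by
    rw [linQ, matQ, h.map_coe, add_sub_cancel_left]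
  rw [IsR1U, h1]
  constructor
  · refine ⟨2, ?_⟩
    rw [pow_two, Module.End.mul_eq_comp, ← mulVecLin_mul, vecMulVec_mul_vecMulVec,
      intCast_dotProduct, h.orth]
    simp
  · rw [range_mulVecLin_vecMulVec _ (intCast_ne_zero hξ), finrank_span_singleton (intCast_ne_zero hx)]

lemma act_mk (h : IsTv u x ξ) {y : Fin n → ℝ} (hy : y ≠ 0) :
    ∃ hy' : y + ((fun i => (ξ i : ℝ)) ⬝ᵥ y) • (fun i => (x i : ℝ)) ≠ 0,
      act u (Projectivization.mk ℝ y hy) = Projectivization.mk ℝ _ hy' := by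
  have h1 : (SpecialLinearGroup.toLin' (SpecialLinearGroup.map (Int.castRingHom ℝ) u)) y =
      y + ((fun i => (ξ i : ℝ)) ⬝ᵥ y) • (fun i => (x i : ℝ)) := by
    rw [SpecialLinearGroup.toLin'_apply, toLin'_apply, h.map_coe, add_mulVec, one_mulVec,
      vecMulVec_mulVec, op_smul_eq_smul]
  have h2 := Projectivization.map_mk
    (SpecialLinearGroup.toLin' (SpecialLinearGroup.map (Int.castRingHom ℝ) u)).toLinearMap
    (SpecialLinearGroup.toLin' (SpecialLinearGroup.map (Int.castRingHom ℝ) u)).injective y hy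
  refine ⟨?_, ?_⟩
  · rw [← h1]
    exact (LinearEquiv.map_ne_zero_iff _).2 hy
  · rw [act, actR, h2]
    congr 1

end IsTv

lemma exists_int_multiple {n : ℕ} (v : Fin n → ℚ) :
    ∃ (N : ℤ) (w : Fin n → ℤ), N ≠ 0 ∧ ∀ i, (w i : ℚ) = N * v i := by
  obtain ⟨b, hb⟩ := IsLocalization.exist_integer_multiples_of_finite (nonZeroDivisors ℤ) v
  choose w hw using hb
  exact ⟨b, w, nonZeroDivisors.ne_zero b.2, fun i => by simpa [zsmul_eq_mul] using hw i⟩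

lemma RatPoint.exists_int {n : ℕ} {p : Proj n} (hp : RatPoint p) :
    ∃ (v : Fin n → ℤ) (hv : v ≠ 0),
      p = Projectivization.mk ℝ (fun i => (v i : ℝ)) (intCast_ne_zero hv) := by
  obtain ⟨q, hq⟩ := hp
  have hq0 : q ≠ 0 := by
    rintro rfl
    have h := p.finrank_submodule
    rw [hq] at h
    have h0 : (fun i : Fin n => (((0 : Fin n → ℚ) i : ℚ) : ℝ)) = 0 := by ext; simp
    rw [h0, Submodule.span_zero_singleton] at h
    simp at h
  obtain ⟨N, w, hN, hw⟩ := exists_int_multiple q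
  have hw' : ∀ i, (w i : ℝ) = N * (q i : ℝ) := fun i => by exact_mod_cast congrArg ((↑) : ℚ → ℝ) (hw i)
  have hw0 : w ≠ 0 := by
    rintro rfl
    apply hq0
    ext i
    have := hw i
    simpa [hN] using this
  refine ⟨w, hw0, Projectivization.submodule_injective ?_⟩
  rw [hq, Projectivization.submodule_mk]
  have h1 : (fun i => (w i : ℝ)) = (N : ℝ) • fun i => (q i : ℝ) := by
    ext i
    simp [hw']
  rw [h1, Submodule.span_singleton_smul_eq (IsUnit.mk0 _ (Int.cast_ne_zero.2 hN))]

lemma IsRatSubmodule.exists_int {n : ℕ} (hn : n ≠ 0) {W : Submodule ℝ (Fin n → ℝ)}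
    (hW : IsRatSubmodule W) (hWrank : Module.finrank ℝ W = n - 1) :
    ∃ φ : Fin n → ℤ, φ ≠ 0 ∧ ∀ y, y ∈ W ↔ (fun i => (φ i : ℝ)) ⬝ᵥ y = 0 := by
  obtain ⟨T, hT⟩ := hW
  have hlt : Submodule.span ℚ T < ⊤ := by
    rw [lt_top_iff_ne_top]
    intro htop
    let c : (Fin n → ℚ) →ₗ[ℚ] (Fin n → ℝ) := (Algebra.linearMap ℚ ℝ).compLeft (Fin n)
    have hc : Submodule.span ℚ T ≤ (W.restrictScalars ℚ).comap c := by
      rw [Submodule.span_le]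
      intro t ht
      change c t ∈ W
      rw [hT]
      exact Submodule.subset_span ⟨t, ht, rfl⟩
    have hWtop : W = ⊤ := by
      rw [eq_top_iff, ← (Pi.basisFun ℝ (Fin n)).span_eq, Submodule.span_le]
      rintro _ ⟨i, rfl⟩
      have h1 : c (Pi.single i 1) ∈ W := hc (htop ▸ Submodule.mem_top)
      have h2 : Pi.basisFun ℝ (Fin n) i = c (Pi.single i 1) := by
        ext j
        simp [c, Pi.single_apply, apply_ite]
      rwa [← h2] at h1
    rw [hWtop, finrank_top, Module.finrank_fin_fun] at hWrank
    omega
  obtain ⟨f, hf0, hf⟩ := Submodule.exists_le_ker_of_lt_top _ hlt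
  obtain ⟨N, φ, hN, hφ⟩ := exists_int_multiple fun i => f (Pi.single i 1)
  have hfφ : ∀ t, (fun i => (φ i : ℚ)) ⬝ᵥ t = N * f t := fun t => by
    conv_rhs => rw [LinearMap.pi_apply_eq_sum_univ f t, Finset.mul_sum]
    refine Finset.sum_congr rfl fun i _ => ?_
    have hs : (fun j => if i = j then (1 : ℚ) else 0) = Pi.single i 1 := by
      ext j; simp [Pi.single_apply, eq_comm]
    rw [hs, smul_eq_mul]
    change (φ i : ℚ) * t i = _
    rw [hφ]
    ring
  have hφ0 : φ ≠ 0 := by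
    rintro rfl
    apply hf0
    ext t
    have := hfφ (Pi.single t 1)
    simpa [hN, dotProduct] using this
  refine ⟨φ, hφ0, ?_⟩
  let F : Module.Dual ℝ (Fin n → ℝ) := dotProductBilin ℝ ℝ fun i => (φ i : ℝ)
  have hF : ∀ y, F y = (fun i => (φ i : ℝ)) ⬝ᵥ y := fun y => rfl
  have hF0 : F ≠ 0 := by
    intro h0
    obtain ⟨i, hi⟩ := Function.ne_iff.1 hφ0
    have h1 := hF (Pi.single i 1)
    rw [h0, dotProduct_single_one, LinearMap.zero_apply] at h1
    exact hi (by exact_mod_cast h1.symm)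
  have hle : W ≤ LinearMap.ker F := by
    rw [hT, Submodule.span_le]
    rintro _ ⟨t, ht, rfl⟩
    have h1 := hfφ t
    rw [LinearMap.mem_ker.1 (hf (Submodule.subset_span ht)), mul_zero] at h1
    change F _ = 0
    rw [hF]
    have h2 := congrArg ((↑) : ℚ → ℝ) h1
    simpa [dotProduct] using h2
  have heq : W = LinearMap.ker F := by
    refine Submodule.eq_of_le_of_finrank_eq hle ?_
    have := Module.Dual.finrank_ker_add_one_of_ne_zero hF0
    rw [Module.finrank_fin_fun] at this
    omega
  intro y
  rw [heq, LinearMap.mem_ker, hF]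

lemma mem_oThick_of_act_zpow {n : ℕ} {V U : Set (Proj n)} (hU : IsOpen U) (hV : IsOpen V)
    {u : SLZ n} {x ξ : Fin n → ℤ} (hu : IsTv u x ξ) (hx : x ≠ 0)
    (hxV : Projectivization.mk ℝ (fun i => (x i : ℝ)) (intCast_ne_zero hx) ∈ V)
    (hξ : hypSet (fun i => (ξ i : ℝ)) ⊆ U) :
    ∀ᶠ M : ℕ in Filter.atTop, ∀ K : ℕ, M ≤ K → ∀ k : ℤ, k ≠ 0 → ∀ q ∉ U, act ((u ^ K) ^ k) q ∈ V := by
  obtain ⟨M₀, hM₀⟩ := exists_forall_mk_mem hU hV (intCast_ne_zero hx) hxV hξ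
  filter_upwards [Filter.eventually_ge_atTop ⌈M₀⌉₊] with M hM K hK k hk q hq
  induction q using Projectivization.ind with
  | h y hy =>
    have h1 : IsTv ((u ^ K) ^ k) ((K * k : ℤ) • x) ξ := by
      rw [← zpow_natCast, ← _root_.zpow_mul]
      exact hu.zpow _
    obtain ⟨hy', h2⟩ := h1.act_mk hy
    rw [h2]
    have h3 : y + ((fun i => (ξ i : ℝ)) ⬝ᵥ y) • (fun i => ((((K * k : ℤ) • x) i : ℤ) : ℝ)) =
        y + (((K * k : ℤ) : ℝ) * ((fun i => (ξ i : ℝ)) ⬝ᵥ y)) • (fun i => (x i : ℝ)) := by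
      ext i
      simp
      ring
    have h4 := hy'
    rw [h3] at h4
    have h5 := hM₀ ((K * k : ℤ) : ℝ) ?_ y hy hq h4
    · convert h5 using 1
      congr 1
    · have h6 : (1 : ℝ) ≤ |(k : ℝ)| := by exact_mod_cast Int.one_le_abs hk
      have h7 : M₀ ≤ K := (Nat.le_ceil _).trans (by exact_mod_cast hM.trans hK)
      push_cast
      rw [abs_mul, Nat.abs_cast]
      nlinarith [Nat.cast_nonneg (α := ℝ) K]

theorem exists_forall_isSchottky {n : ℕ} {d : Proj n → Proj n → ℝ} (hd : IsCompatMetric d)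
    {J : Type*} [Finite J] [Nonempty J] {u : J → SLZ n} {x ξ : J → Fin n → ℤ}
    (hu : ∀ j, IsTv (u j) (x j) (ξ j)) (hx : ∀ j, x j ≠ 0) (hξ : ∀ j, ξ j ≠ 0)
    (hpair : ∀ i j, i ≠ j → ξ j ⬝ᵥ x i ≠ 0) {p : Proj n} {B : Set (Proj n)} (hp : p ∈ B)
    {ε δ : ℝ} (hε : 0 < ε) (hεδ : ε ≤ δ)
    (hpt : ∀ j, Projectivization.mk ℝ (fun i => (x j i : ℝ)) (intCast_ne_zero (hx j)) ∈
      oThick d {p} (ε / 2))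
    (hhyp : ∀ j, hypSet (fun i => (ξ j i : ℝ)) ⊆ oThick d B (δ / 2)) :
    ∃ M : ℕ, ∀ K : J → ℕ, (∀ j, M ≤ K j) →
      IsSchottky d (Set.range fun j => u j ^ K j) (cThick d {p} ε) (cThick d B δ) := by
  set P : J → Proj n := fun j =>
    Projectivization.mk ℝ (fun i => (x j i : ℝ)) (intCast_ne_zero (hx j)) with hP
  set L : J → Set (Proj n) := fun j => hypSet fun i => (ξ j i : ℝ) with hL
  have hPL : ∀ i j, P i ∈ L j ↔ ξ j ⬝ᵥ x i = 0 := fun i j => by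
    rw [hP, hL, mk_mem_hypSet, intCast_dotProduct, Int.cast_eq_zero]
  have hLne : ∀ j, (L j).Nonempty := fun j => ⟨P j, (hPL j j).2 (hu j).orth⟩
  obtain ⟨η, ⟨hη0, hη⟩, hdisj⟩ : ∃ η, η ∈ Set.Ioo 0 (ε / 2) ∧ ∀ i j, i ≠ j →
      oThick d {P i} η ∩ oThick d (L j) η = ∅ := by
    have h1 : ∀ i j, ∀ᶠ η in nhdsWithin (0 : ℝ) (Set.Ioi 0), i ≠ j →
        oThick d {P i} η ∩ oThick d (L j) η = ∅ := fun i j => by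
      by_cases hij : i = j
      · exact Filter.Eventually.of_forall fun _ h => absurd hij h
      · filter_upwards [hd.eventually_disjoint (hLne j) (isClosed_hypSet _)
          (fun h => hpair i j hij ((hPL i j).1 h))] with η h _ using h
    exact ((Filter.Eventually.and (Ioo_mem_nhdsGT (half_pos hε))
      (Filter.eventually_all.2 fun i => Filter.eventually_all.2 (h1 i)))).exists
  have hM : ∀ j, ∀ᶠ M : ℕ in Filter.atTop, ∀ K : ℕ, M ≤ K → ∀ k : ℤ, k ≠ 0 →
      ∀ q ∉ oThick d (L j) η, act ((u j ^ K) ^ k) q ∈ oThick d {P j} η := fun j =>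
    mem_oThick_of_act_zpow (hd.isOpen_oThick (hLne j) η)
      (hd.isOpen_oThick (Set.singleton_nonempty _) η) (hu j) (hx j)
      (hd.subset_oThick hη0 rfl) (hd.subset_oThick hη0)
  obtain ⟨M, hM, hM1⟩ := ((Filter.eventually_all.2 hM).and (Filter.eventually_gt_atTop 0)).exists
  refine ⟨M, fun K hK => ?_⟩
  have hK0 : ∀ j, (K j : ℤ) ≠ 0 := fun j => by have := hK j; omega
  have htv : ∀ j, IsTv (u j ^ K j) ((K j : ℤ) • x j) (ξ j) := fun j => (hu j).pow _
  have hKx : ∀ j, (K j : ℤ) • x j ≠ 0 := fun j => smul_ne_zero (hK0 j) (hx j)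
  have hatt : ∀ j, attSet (u j ^ K j) = {P j} := fun j => by
    rw [(htv j).attSet_eq (hKx j) (hξ j)]
    congr 1
    refine (Projectivization.mk_eq_mk_iff' ℝ _ _ _ _).2 ⟨(K j : ℝ), ?_⟩
    ext i
    simp
  have hfix : ∀ j, fixSet (u j ^ K j) = L j := fun j => (htv j).fixSet_eq (hKx j)
  refine
    { nonempty := Set.range_nonempty _
      unip := ?_
      AsubR := hd.cThick_singleton_subset hp hεδ
      closedA := hd.isClosed_cThick (Set.singleton_nonempty p) ε
      closedR := hd.isClosed_cThick ⟨p, hp⟩ δ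
      cond := ⟨fun _ => η, fun _ => η, fun _ _ => ⟨hη0, le_rfl⟩, ?_, ?_, ?_, ?_⟩ }
  · rintro _ ⟨j, rfl⟩
    exact (htv j).isR1U (hKx j) (hξ j)
  · rintro _ ⟨j, rfl⟩ k hk q hq
    rw [hatt]
    rw [hfix] at hq
    exact hM j (K j) (hK j) k hk q hq
  · rintro _ ⟨i, rfl⟩ _ ⟨j, rfl⟩ hij
    rw [hatt, hfix]
    refine hdisj i j ?_
    rintro rfl
    exact hij rfl
  · rintro _ ⟨j, rfl⟩
    rw [hatt]
    exact hd.oThick_subset_cThick (Set.singleton_nonempty _) (Set.singleton_subset_iff.2 (hpt j))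
      (Set.singleton_nonempty p) hη.le
  · rintro _ ⟨j, rfl⟩
    rw [hfix]
    exact hd.oThick_subset_cThick (hLne j) (hhyp j) ⟨p, hp⟩ (by linarith)

/-- Proposition 2.11: for a rational point `p` on a rational hyperplane `L` and
`δ ≥ ε > 0`, there is a finite Schottky set `S` with respect to `𝒜 = [p]_ε` and
`ℛ = [L]_δ` generating a profinitely dense subgroup of `SL(n,ℤ)`. -/
theorem exists_profinitely_dense_schottky (n : ℕ) (hn : 3 ≤ n)
    (d : Proj n → Proj n → ℝ) (hd : IsCompatMetric d)
    (p : Proj n) (hp : RatPoint p)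
    (W : Submodule ℝ (Fin n → ℝ)) (hW : IsRatSubmodule W)
    (hWrank : Module.finrank ℝ W = n - 1) (hpW : p.submodule ≤ W)
    (ε δ : ℝ) (hε : 0 < ε) (hεδ : ε ≤ δ) :
    ∃ S : Set (SLZ n), S.Finite ∧
      IsSchottky d S (cThick d {p} ε) (cThick d (projSet W) δ) ∧
      ProfinitelyDense (Subgroup.closure S) := by
  obtain ⟨v, hv, hpv⟩ := hp.exists_int
  obtain ⟨φ, hφ, hWφ⟩ := hW.exists_int (by omega) hWrank
  have hproj : projSet W = hypSet fun i => (φ i : ℝ) := by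
    ext q
    exact forall₂_congr fun y _ => hWφ y
  have hpB : p ∈ projSet W := hpW
  have hφv : φ ⬝ᵥ v = 0 := by
    rwa [hproj, hpv, mk_mem_hypSet, intCast_dotProduct, Int.cast_eq_zero] at hpB
  obtain ⟨g, hg⟩ := IsTv.exists_of_orth hφv
  obtain ⟨ι, _, u, x, ξ, F, hξv, hφx⟩ := exists_fam_transverse hn hv hφ
  have : Nonempty ι := ⟨(F.exists_dotProduct_ne_zero hn hv).choose⟩
  let m : Bool → ℕ := fun e => cond e 2 1
  have hm : ∀ e, (m e : ℝ) ≠ 0 := by rintro (_ | _) <;> simp [m]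
  have hm' : ∀ e e', e ≠ e' → ((m e : ℤ) - m e') ≠ 0 := by rintro (_ | _) (_ | _) <;> simp [m]
  have hev1 : ∀ j : ι × Bool, ∀ᶠ a : ℕ in Filter.atTop,
      ∀ h : (fun i => (x j.1 i : ℝ)) + (a * (m j.2 * ((φ ⬝ᵥ x j.1 : ℤ) : ℝ))) •
        (fun i => (v i : ℝ)) ≠ 0, Projectivization.mk ℝ _ h ∈ oThick d {p} (ε / 2) := fun j =>
    eventually_mk_mem (hd.isOpen_oThick (Set.singleton_nonempty p) _) (intCast_ne_zero hv)
      (hd.subset_oThick (half_pos hε) hpv.symm) _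
      (mul_ne_zero (hm _) (Int.cast_ne_zero.2 (hφx _)))
  have hev2 : ∀ j : ι × Bool, ∀ᶠ a : ℕ in Filter.atTop,
      hypSet ((fun i => (ξ j.1 i : ℝ)) - (a * (m j.2 * ((ξ j.1 ⬝ᵥ v : ℤ) : ℝ))) •
        (fun i => (φ i : ℝ))) ⊆ oThick d (projSet W) (δ / 2) := fun j =>
    eventually_hypSet_subset (hd.isOpen_oThick ⟨p, hpB⟩ _)
      (hproj ▸ hd.subset_oThick (half_pos (hε.trans_le hεδ))) _
      (mul_ne_zero (hm _) (Int.cast_ne_zero.2 (hξv _)))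
  have hev3 : ∀ i j : ι × Bool, ∀ᶠ a : ℕ in Filter.atTop, i ≠ j →
      (ξ j.1 - ((a * m j.2 : ℤ) * (ξ j.1 ⬝ᵥ v)) • φ) ⬝ᵥ
        (x i.1 + ((a * m i.2 : ℤ) * (φ ⬝ᵥ x i.1)) • v) ≠ 0 := fun i j => by
    have hrw : ∀ a : ℕ, (ξ j.1 - ((a * m j.2 : ℤ) * (ξ j.1 ⬝ᵥ v)) • φ) ⬝ᵥ
        (x i.1 + ((a * m i.2 : ℤ) * (φ ⬝ᵥ x i.1)) • v) =
        ξ j.1 ⬝ᵥ x i.1 + a * (((m i.2 : ℤ) - m j.2) * ((φ ⬝ᵥ x i.1) * (ξ j.1 ⬝ᵥ v))) := fun a => by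
      simp only [sub_dotProduct, dotProduct_add, dotProduct_smul, smul_dotProduct, hφv, smul_eq_mul]
      ring
    simp only [hrw]
    by_cases he : i.2 = j.2
    · refine Filter.Eventually.of_forall fun a hij => ?_
      rw [he, sub_self, zero_mul, mul_zero, add_zero]
      exact F.pair _ _ fun h => hij (Prod.ext h he)
    · filter_upwards [eventually_add_mul_ne_zero (ξ j.1 ⬝ᵥ x i.1)
        (mul_ne_zero (hm' _ _ he) (mul_ne_zero (hφx i.1) (hξv j.1)))] with a ha _ using ha
  obtain ⟨a, ⟨ha1, ha2⟩, ha3⟩ := (((Filter.eventually_all.2 hev1).and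
    (Filter.eventually_all.2 hev2)).and
      (Filter.eventually_all.2 fun i => Filter.eventually_all.2 (hev3 i))).exists
  have hF := fun e : Bool => F.conj_zpow hg (a * m e : ℤ)
  let u' : ι × Bool → SLZ n := fun j => g ^ (a * m j.2 : ℤ) * u j.1 * (g ^ (a * m j.2 : ℤ))⁻¹
  let x' : ι × Bool → Fin n → ℤ := fun j => x j.1 + ((a * m j.2 : ℤ) * (φ ⬝ᵥ x j.1)) • v
  let ξ' : ι × Bool → Fin n → ℤ := fun j => ξ j.1 - ((a * m j.2 : ℤ) * (ξ j.1 ⬝ᵥ v)) • φ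
  have hpair : ∀ i j, i ≠ j → ξ' j ⬝ᵥ x' i ≠ 0 := ha3
  have hother : ∀ j : ι × Bool, j ≠ (j.1, !j.2) := by
    rintro ⟨i, _ | _⟩ <;> simp
  have hx' : ∀ j, x' j ≠ 0 := fun j h => hpair j _ (hother j) (by rw [h, dotProduct_zero])
  have hξ' : ∀ j, ξ' j ≠ 0 := fun j h => hpair _ j (hother j).symm (by rw [h, zero_dotProduct])
  obtain ⟨M, hM⟩ := exists_forall_isSchottky hd (u := u') (x := x') (ξ := ξ')
    (fun j => (hF j.2).tv j.1) hx' hξ' hpair hpB hε hεδ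
    (fun j => by
      have h1 : (fun i => (x' j i : ℝ)) = (fun i => (x j.1 i : ℝ)) +
          (a * (m j.2 * ((φ ⬝ᵥ x j.1 : ℤ) : ℝ))) • (fun i => (v i : ℝ)) := by
        ext i
        simp [x', mul_assoc]
      have h2 := intCast_ne_zero (R := ℝ) (hx' j)
      have h3 := ha1 j (h1 ▸ h2)
      simpa only [h1] using h3)
    (fun j => by
      have h1 : (fun i => (ξ' j i : ℝ)) = (fun i => (ξ j.1 i : ℝ)) -
          (a * (m j.2 * ((ξ j.1 ⬝ᵥ v : ℤ) : ℝ))) • (fun i => (φ i : ℝ)) := by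
        ext i
        simp [ξ', mul_assoc]
      rw [h1]
      exact ha2 j)
  let K : ι × Bool → ℕ := fun j => cond j.2 3 2 ^ M
  have hK : ∀ j, M ≤ K j := by
    rintro ⟨i, _ | _⟩
    · exact (Nat.lt_pow_self (by norm_num)).le
    · exact (Nat.lt_pow_self (by norm_num)).le
  refine ⟨_, Set.finite_range _, hM K hK,
    profinitelyDense_of_pow_mem hn M _ _ (hF false).gen (hF true).gen ?_ ?_ _ ?_ ?_⟩
  · rintro _ ⟨i, rfl⟩
    exact (hF false).conj_tv i
  · rintro _ ⟨i, rfl⟩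
    exact (hF true).conj_tv i
  · rintro _ ⟨i, rfl⟩
    exact Subgroup.subset_closure ⟨(i, false), rfl⟩
  · rintro _ ⟨i, rfl⟩
    exact Subgroup.subset_closure ⟨(i, true), rfl⟩
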